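/- arXiv:2301.05140 — 9 statements merged into one kernel-verified Lean document; each statement's English description precedes it below -/
import Mathlib

section
/- Let f : ℝⁿ → ℝⁿ be continuously differentiable, type-K monotone and plus-homogeneous, and suppose f has at least one fixed point. Then for every initial condition ξ ∈ ℝⁿ there exists a point x_ξ ∈ ℝⁿ with f(x_ξ) = x_ξ such that the iterates f^[k](ξ) converge to x_ξ as k → ∞. -/
open Filter

/-- Plus-homogeneous monotone maps are nonexpansive for the sup norm. -/
theorem kt_nonexp {n : ℕ} {f : (Fin n → ℝ) → (Fin n → ℝ)}
    (hmono : ∀ x y : Fin n → ℝ, x ≤ y → f x ≤ f y)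
    (hph : ∀ (x : Fin n → ℝ) (α : ℝ), f (x + α • (1 : Fin n → ℝ)) = f x + α • (1 : Fin n → ℝ))
    (x y : Fin n → ℝ) : dist (f x) (f y) ≤ dist x y := by
  have key : ∀ x y : Fin n → ℝ, ∀ i, f x i - f y i ≤ dist x y := by
    intro x y i
    have h : x ≤ y + (dist x y) • (1 : Fin n → ℝ) := by
      intro j
      have h1 := dist_le_pi_dist x y j
      rw [Real.dist_eq] at h1
      have h2 := (abs_le.mp h1).2
      simp only [Pi.add_apply, Pi.smul_apply, Pi.one_apply, smul_eq_mul, mul_one]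
      linarith
    have h3 := hmono _ _ h i
    rw [hph] at h3
    simp only [Pi.add_apply, Pi.smul_apply, Pi.one_apply, smul_eq_mul, mul_one] at h3
    linarith
  rw [dist_pi_le_iff dist_nonneg]
  intro i
  rw [Real.dist_eq, abs_le]
  have h1 := key x y i
  have h2 := key y x i
  rw [dist_comm] at h2
  constructor <;> linarith

/-- Iterates stay within the initial distance from a fixed point. -/
theorem kt_dist_iter {n : ℕ} {f : (Fin n → ℝ) → (Fin n → ℝ)}
    (hne : ∀ x y, dist (f x) (f y) ≤ dist x y) {p : Fin n → ℝ} (hp : f p = p)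
    (x : Fin n → ℝ) : Antitone (fun k : ℕ => dist (f^[k] x) p) := by
  refine antitone_nat_of_succ_le fun k => ?_
  rw [Function.iterate_succ_apply']
  have := hne (f^[k] x) p
  rwa [hp] at this

/-- Limit points of an orbit satisfy `f z ≤ z`. -/
theorem kt_limit_le {n : ℕ} {f : (Fin n → ℝ) → (Fin n → ℝ)}
    (hc : Continuous f)
    (hmono : ∀ x y : Fin n → ℝ, x ≤ y → f x ≤ f y)
    (hK : ∀ (i : Fin n) (x y : Fin n → ℝ), x ≤ y → x i < y i → f x i < f y i)
    (hph : ∀ (x : Fin n → ℝ) (α : ℝ), f (x + α • (1 : Fin n → ℝ)) = f x + α • (1 : Fin n → ℝ))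
    {p : Fin n → ℝ} (hp : f p = p) {ξ z : Fin n → ℝ} {φ : ℕ → ℕ} (hφ : StrictMono φ)
    (hz : Tendsto (fun j => f^[φ j] ξ) atTop (nhds z)) : f z ≤ z := by
  intro i₀
  have hn : (Finset.univ : Finset (Fin n)).Nonempty := ⟨i₀, Finset.mem_univ _⟩
  set V : (Fin n → ℝ) → ℝ := fun x => Finset.univ.sup' hn (fun i => f x i - x i) with hV
  have hVc : Continuous V := by
    refine Continuous.finset_sup'_apply hn fun i _ => ?_
    exact ((continuous_apply i).comp hc).sub (continuous_apply i)
  have hVle : ∀ x i, f x i - x i ≤ V x := fun x i =>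
    Finset.le_sup' (fun i => f x i - x i) (Finset.mem_univ i)
  have hle : ∀ x, f x ≤ x + (V x) • (1 : Fin n → ℝ) := by
    intro x i
    have := hVle x i
    simp only [Pi.add_apply, Pi.smul_apply, Pi.one_apply, smul_eq_mul, mul_one]
    linarith
  have hVf : ∀ x, V (f x) ≤ V x := by
    intro x
    refine Finset.sup'_le _ _ fun i _ => ?_
    have h := hmono _ _ (hle x) i
    rw [hph] at h
    simp only [Pi.add_apply, Pi.smul_apply, Pi.one_apply, smul_eq_mul, mul_one] at h
    linarith
  have hanti : Antitone (fun k : ℕ => V (f^[k] ξ)) := by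
    refine antitone_nat_of_succ_le fun k => ?_
    rw [Function.iterate_succ_apply']
    exact hVf _
  have hlim : Tendsto (fun k : ℕ => V (f^[k] ξ)) atTop (nhds (V z)) := by
    rw [tendsto_iff_tendsto_subseq_of_antitone hanti hφ.tendsto_atTop]
    exact (hVc.tendsto z).comp hz
  have hconst : ∀ m : ℕ, V (f^[m] z) = V z := by
    intro m
    have h1 : Tendsto (fun j => V (f^[m] (f^[φ j] ξ))) atTop (nhds (V (f^[m] z))) :=
      ((hVc.comp (hc.iterate m)).tendsto z).comp hz
    have h2 : Tendsto (fun j => V (f^[m] (f^[φ j] ξ))) atTop (nhds (V z)) := by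
      have h3 : Tendsto (fun j => m + φ j) atTop atTop :=
        tendsto_atTop_mono (fun j => Nat.le_add_left _ _) hφ.tendsto_atTop
      have h4 := hlim.comp h3
      simpa [Function.comp_def, Function.iterate_add_apply] using h4
    exact tendsto_nhds_unique h1 h2
  have hback : ∀ i (k : ℕ), f (f^[k] z) i - f^[k] z i < V z →
      ∀ l, k ≤ l → f (f^[l] z) i - f^[l] z i < V z := by
    intro i k hk l hl
    induction l, hl using Nat.le_induction with
    | base => exact hk
    | succ l _ ih =>
      rw [Function.iterate_succ_apply']
      set y := f^[l] z
      have h1 := hle y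
      rw [hconst l] at h1
      have h := hK i _ _ h1 (by
        simp only [Pi.add_apply, Pi.smul_apply, Pi.one_apply, smul_eq_mul, mul_one]
        linarith)
      rw [hph] at h
      simp only [Pi.add_apply, Pi.smul_apply, Pi.one_apply, smul_eq_mul, mul_one] at h
      linarith
  have hex : ∃ i, ∀ k : ℕ, f (f^[k] z) i - f^[k] z i = V z := by
    by_contra hcon
    push Not at hcon
    choose K hKne using hcon
    obtain ⟨i, _, hi⟩ := Finset.exists_mem_eq_sup' hn
      (fun i => f (f^[Finset.univ.sup K] z) i - f^[Finset.univ.sup K] z i)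
    have h1 : f (f^[K i] z) i - f^[K i] z i < V z := by
      refine lt_of_le_of_ne ?_ (hKne i)
      rw [← hconst (K i)]
      exact hVle _ _
    have h2 := hback i (K i) h1 _ (Finset.le_sup (f := K) (Finset.mem_univ i))
    have h3 := hconst (Finset.univ.sup K)
    rw [← h3] at h2
    exact absurd hi (ne_of_gt h2)
  obtain ⟨i, hi⟩ := hex
  have hlin : ∀ k : ℕ, f^[k] z i = z i + k * V z := by
    intro k
    induction k with
    | zero => simp
    | succ k ih =>
      rw [Function.iterate_succ_apply']
      have := hi k
      push_cast
      linarith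
  have hV0 : V z ≤ 0 := by
    by_contra hpos
    push Not at hpos
    obtain ⟨k, hk⟩ := exists_nat_gt ((dist z p + p i - z i) / V z)
    rw [div_lt_iff₀ hpos] at hk
    have h1 := kt_dist_iter (kt_nonexp hmono hph) hp z (Nat.zero_le k)
    have h2 := dist_le_pi_dist (f^[k] z) p i
    rw [Real.dist_eq] at h2
    have h3 := (abs_le.mp h2).2
    have h4 := hlin k
    simp only [Function.iterate_zero, id] at h1
    linarith
  have := hVle z i₀
  linarith

/-- If `f : ℝⁿ → ℝⁿ` is `C¹`, type-K monotone and plus-homogeneous, and `f` has at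
least one fixed point, then for every initial condition `ξ` the iterates `f^[k] ξ` converge to
some fixed point `x_ξ` of `f`. -/
theorem ktopical_iterates_converge_to_fixed_point
    (n : ℕ) (f : (Fin n → ℝ) → (Fin n → ℝ))
    (hC1 : ContDiff ℝ 1 f)
    (hmono : ∀ x y : Fin n → ℝ, x ≤ y → f x ≤ f y)
    (hK : ∀ (i : Fin n) (x y : Fin n → ℝ), x ≤ y → x i < y i → f x i < f y i)
    (hph : ∀ (x : Fin n → ℝ) (α : ℝ), f (x + α • (1 : Fin n → ℝ)) = f x + α • (1 : Fin n → ℝ))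
    (hfix : ∃ x_e : Fin n → ℝ, f x_e = x_e) :
    ∀ ξ : Fin n → ℝ, ∃ xξ : Fin n → ℝ, f xξ = xξ ∧
      Tendsto (fun k : ℕ => f^[k] ξ) atTop (nhds xξ) := by
  intro ξ
  obtain ⟨p, hp⟩ := hfix
  have hc := hC1.continuous
  have hne := kt_nonexp hmono hph
  have hbd : ∀ k : ℕ, f^[k] ξ ∈ Metric.closedBall p (dist ξ p) := fun k =>
    kt_dist_iter hne hp ξ (Nat.zero_le k)
  obtain ⟨z, -, φ, hφ, hz⟩ := (isCompact_closedBall p (dist ξ p)).tendsto_subseq hbd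
  have h1 : f z ≤ z := kt_limit_le hc hmono hK hph hp hφ hz
  have h2 : z ≤ f z := by
    let g : (Fin n → ℝ) → (Fin n → ℝ) := fun x => -f (-x)
    have hit : ∀ (k : ℕ) x, g^[k] (-x) = -f^[k] x := by
      intro k x
      induction k with
      | zero => simp
      | succ k ih =>
        rw [Function.iterate_succ_apply', Function.iterate_succ_apply', ih]
        simp [g]
    have h3 : g (-z) ≤ -z := by
      refine kt_limit_le (f := g) (p := -p) (ξ := -ξ) (φ := φ) (hc.comp continuous_neg).neg
        ?_ ?_ ?_ ?_ hφ ?_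
      · intro x y hxy
        exact neg_le_neg (hmono _ _ (neg_le_neg hxy))
      · intro i x y hxy hi
        exact neg_lt_neg (hK i _ _ (neg_le_neg hxy) (neg_lt_neg hi))
      · intro x α
        have h := hph (-x) (-α)
        have e : -(x + α • (1 : Fin n → ℝ)) = -x + (-α) • (1 : Fin n → ℝ) := by
          rw [neg_add, neg_smul]
        simp only [g]
        rw [e, h, neg_add, neg_smul, neg_neg]
      · simp [g, hp]
      · simp only [hit]
        exact hz.neg
    simpa [g] using h3
  have hfz : f z = z := le_antisymm h1 h2
  refine ⟨z, hfz, ?_⟩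
  rw [tendsto_iff_dist_tendsto_zero]
  rw [tendsto_iff_tendsto_subseq_of_antitone (kt_dist_iter hne hfz ξ) hφ.tendsto_atTop]
  exact tendsto_iff_dist_tendsto_zero.mp hz
end

section
/- Let f : ℝⁿ → ℝⁿ be monotone and plus-homogeneous, and let x_e ∈ ℝⁿ be a fixed point of f. Then x_e is Lyapunov stable for the discrete-time system x(k+1) = f(x(k)): for every ε > 0 there exists δ > 0 such that every ξ ∈ ℝⁿ with ‖ξ − x_e‖_∞ < δ satisfies ‖f^[k](ξ) − x_e‖_∞ < ε for all k ∈ ℕ. -/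
/-- If `f : ℝⁿ → ℝⁿ` is monotone and plus-homogeneous and `x_e` is a fixed point
of `f`, then `x_e` is Lyapunov stable for `x(k+1) = f(x(k))` in the sup-norm (the norm on
`Fin n → ℝ`). -/
theorem topical_fixed_point_stable
    (n : ℕ) (f : (Fin n → ℝ) → (Fin n → ℝ))
    (hmono : ∀ x y : Fin n → ℝ, x ≤ y → f x ≤ f y)
    (hph : ∀ (x : Fin n → ℝ) (α : ℝ), f (x + α • (1 : Fin n → ℝ)) = f x + α • (1 : Fin n → ℝ))
    (x_e : Fin n → ℝ) (hfix : f x_e = x_e) :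
    ∀ ε > (0 : ℝ), ∃ δ > (0 : ℝ), ∀ ξ : Fin n → ℝ, ‖ξ - x_e‖ < δ →
      ∀ k : ℕ, ‖f^[k] ξ - x_e‖ < ε := by
  intro ε hε
  refine ⟨ε, hε, fun ξ hξ k => ?_⟩
  induction k with
  | zero => simpa using hξ
  | succ k ih =>
    rw [Function.iterate_succ_apply']
    refine lt_of_le_of_lt ?_ ih
    generalize f^[k] ξ = y
    have hy : ∀ i, |y i - x_e i| ≤ ‖y - x_e‖ := fun i => by
      have := norm_le_pi_norm (y - x_e) i
      simpa [Real.norm_eq_abs] using this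
    have h1 := hmono y (x_e + ‖y - x_e‖ • (1 : Fin n → ℝ)) (fun i => by
      have := (abs_le.1 (hy i)).2
      simp only [Pi.add_apply, Pi.smul_apply, Pi.one_apply, smul_eq_mul, mul_one]
      linarith)
    have h2 := hmono (x_e + (-‖y - x_e‖) • (1 : Fin n → ℝ)) y (fun i => by
      have := (abs_le.1 (hy i)).1
      simp only [Pi.add_apply, Pi.smul_apply, Pi.one_apply, smul_eq_mul, mul_one]
      linarith)
    rw [hph, hfix] at h1 h2
    refine (pi_norm_le_iff_of_nonneg (norm_nonneg _)).2 fun i => ?_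
    have a := h1 i
    have b := h2 i
    simp only [Pi.add_apply, Pi.smul_apply, Pi.one_apply, smul_eq_mul, mul_one] at a b
    rw [Real.norm_eq_abs, Pi.sub_apply, abs_le]
    constructor <;> linarith
end

section
/- Let f : ℝⁿ → ℝⁿ be continuously differentiable, satisfy f(x + α𝟏) = f(x) for all x ∈ ℝⁿ and α ∈ ℝ, and have a Metzler Jacobian, i.e. ∂f_i/∂x_j(x) ≥ 0 for all i ≠ j and all x ∈ ℝⁿ. Then for every initial condition ξ ∈ ℝⁿ there exists a unique function x : [0, ∞) → ℝⁿ with x(0) = ξ that is differentiable and satisfies x'(t) = f(x(t)) for all t ≥ 0 (i.e., solutions of ẋ = f(x) exist globally forward in time and are unique). -/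
open Set Filter Topology Metric

/-- Kamke condition. -/
theorem topical_kamke (n : ℕ) (f : (Fin n → ℝ) → (Fin n → ℝ))
    (hC1 : ContDiff ℝ 1 f)
    (hMetzler : ∀ (x : Fin n → ℝ) (i j : Fin n), i ≠ j →
      0 ≤ fderiv ℝ f x (Pi.single j 1) i)
    (x y : Fin n → ℝ) (hxy : ∀ j, x j ≤ y j) (i : Fin n) (hi : x i = y i) :
    f x i ≤ f y i := by
  have hd : ∀ s : ℝ, HasDerivAt (fun s : ℝ => f (x + s • (y - x)) i)
      (fderiv ℝ f (x + s • (y - x)) (y - x) i) s := by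
    intro s
    have h1 : HasDerivAt (fun s : ℝ => x + s • (y - x)) (y - x) s := by
      simpa using ((hasDerivAt_id s).smul_const (y - x)).const_add x
    have h2 : HasFDerivAt f (fderiv ℝ f (x + s • (y - x))) (x + s • (y - x)) :=
      ((hC1.differentiable one_ne_zero) _).hasFDerivAt
    have h3 := h2.comp_hasDerivAt s h1
    exact (hasDerivAt_pi.1 h3) i
  have hm := monotone_of_hasDerivAt_nonneg hd (by
    intro s
    have he : y - x = ∑ j, (y j - x j) • (Pi.single j (1 : ℝ) : Fin n → ℝ) := by
      ext k
      simp [Finset.sum_apply, Pi.single_apply]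
    simp only [Pi.zero_apply]
    generalize x + s • (y - x) = w
    rw [he, map_sum, Finset.sum_apply]
    apply Finset.sum_nonneg
    intro j _
    rw [map_smul, Pi.smul_apply, smul_eq_mul]
    by_cases hij : i = j
    · subst hij
      simp [hi]
    · exact mul_nonneg (sub_nonneg.2 (hxy j)) (hMetzler w i j hij))
  have := hm (zero_le_one : (0 : ℝ) ≤ 1)
  simpa using this

/-- Coordinatewise clamping to the box of radius `R` about `ξ`. -/
noncomputable def topicalClamp {n : ℕ} (ξ : Fin n → ℝ) (R : ℝ) (x : Fin n → ℝ) : Fin n → ℝ :=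
  fun i => max (ξ i - R) (min (x i) (ξ i + R))

theorem topicalClamp_mem {n : ℕ} (ξ : Fin n → ℝ) (R : ℝ) (hR : 0 ≤ R) (x : Fin n → ℝ) :
    topicalClamp ξ R x ∈ closedBall ξ R := by
  rw [mem_closedBall, dist_pi_le_iff hR]
  intro i
  rw [Real.dist_eq, abs_le]
  unfold topicalClamp
  constructor
  · linarith [le_max_left (ξ i - R) (min (x i) (ξ i + R))]
  · have : max (ξ i - R) (min (x i) (ξ i + R)) ≤ ξ i + R :=
      max_le (by linarith) (min_le_right _ _)
    linarith

theorem topicalClamp_of_mem {n : ℕ} (ξ : Fin n → ℝ) (R : ℝ) (hR : 0 ≤ R) (x : Fin n → ℝ)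
    (hx : x ∈ closedBall ξ R) : topicalClamp ξ R x = x := by
  rw [mem_closedBall, dist_pi_le_iff hR] at hx
  ext i
  have := hx i
  rw [Real.dist_eq, abs_le] at this
  unfold topicalClamp
  rw [min_eq_left (by linarith), max_eq_right (by linarith)]

theorem topicalClamp_lipschitz {n : ℕ} (ξ : Fin n → ℝ) (R : ℝ) :
    LipschitzWith 1 (topicalClamp ξ R) := by
  apply LipschitzWith.of_dist_le_mul
  intro x y
  rw [NNReal.coe_one, one_mul, dist_pi_le_iff dist_nonneg]
  intro i
  refine le_trans ?_ (dist_le_pi_dist x y i)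
  unfold topicalClamp
  rw [Real.dist_eq, Real.dist_eq]
  calc _ ≤ |min (x i) (ξ i + R) - min (y i) (ξ i + R)| := by
        simpa using abs_max_sub_max_le_max (ξ i - R) (min (x i) (ξ i + R)) (ξ i - R)
          (min (y i) (ξ i + R))
    _ ≤ |x i - y i| := by
        simpa using abs_min_sub_min_le_max (x i) (ξ i + R) (y i) (ξ i + R)

theorem topical_upper (n : ℕ) (f : (Fin n → ℝ) → (Fin n → ℝ))
    (hC1 : ContDiff ℝ 1 f)
    (hph : ∀ (x : Fin n → ℝ) (α : ℝ), f (x + α • (1 : Fin n → ℝ)) = f x)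
    (hMetzler : ∀ (x : Fin n → ℝ) (i j : Fin n), i ≠ j →
      0 ≤ fderiv ℝ f x (Pi.single j 1) i)
    (ξ x : Fin n → ℝ) (R : ℝ) (i : Fin n) (hi : ∀ j, x j - ξ j ≤ x i - ξ i) :
    f (topicalClamp ξ R x) i ≤ f ξ i := by
  set c := topicalClamp ξ R x with hc
  rw [← hph ξ (c i - ξ i)]
  apply topical_kamke n f hC1 hMetzler
  · intro j
    have := hi j
    simp only [hc, topicalClamp, Pi.add_apply, Pi.smul_apply, Pi.one_apply, smul_eq_mul, mul_one]
    grind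
  · simp

theorem topical_lower (n : ℕ) (f : (Fin n → ℝ) → (Fin n → ℝ))
    (hC1 : ContDiff ℝ 1 f)
    (hph : ∀ (x : Fin n → ℝ) (α : ℝ), f (x + α • (1 : Fin n → ℝ)) = f x)
    (hMetzler : ∀ (x : Fin n → ℝ) (i j : Fin n), i ≠ j →
      0 ≤ fderiv ℝ f x (Pi.single j 1) i)
    (ξ x : Fin n → ℝ) (R : ℝ) (i : Fin n) (hi : ∀ j, x i - ξ i ≤ x j - ξ j) :
    f ξ i ≤ f (topicalClamp ξ R x) i := by
  set c := topicalClamp ξ R x with hc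
  rw [← hph ξ (c i - ξ i)]
  apply topical_kamke n f hC1 hMetzler
  · intro j
    have := hi j
    simp only [hc, topicalClamp, Pi.add_apply, Pi.smul_apply, Pi.one_apply, smul_eq_mul, mul_one]
    grind
  · simp

/-- One-sided growth of a scalar function. -/
theorem topical_scalar {u : ℝ → ℝ} {u' t N M r : ℝ} (hu : HasDerivAt u u' t) (hN : u t ≤ N)
    (hM : u t = N → u' ≤ M) (hMr : M < r) (hr : 0 ≤ r) :
    ∀ᶠ z in 𝓝[>] t, u z < N + r * (z - t) := by
  rcases hN.lt_or_eq with h | h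
  · have h1 : ∀ᶠ z in 𝓝[>] t, u z < N :=
      (hu.continuousAt.eventually (gt_mem_nhds h)).filter_mono nhdsWithin_le_nhds
    filter_upwards [h1, self_mem_nhdsWithin] with z hz hz'
    have : 0 ≤ r * (z - t) := mul_nonneg hr (sub_nonneg.2 (le_of_lt hz'))
    linarith
  · have h1 := (hu.hasDerivWithinAt (s := Ioi t)).limsup_slope_le' (by simp)
      ((hM h).trans_lt hMr)
    filter_upwards [h1, self_mem_nhdsWithin] with z hz hz'
    have hz'' : 0 < z - t := sub_pos.2 hz'
    rw [slope_def_field, div_lt_iff₀ hz''] at hz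
    linarith

theorem topical_finite (n : ℕ) (f : (Fin n → ℝ) → (Fin n → ℝ))
    (hC1 : ContDiff ℝ 1 f)
    (hph : ∀ (x : Fin n → ℝ) (α : ℝ), f (x + α • (1 : Fin n → ℝ)) = f x)
    (hMetzler : ∀ (x : Fin n → ℝ) (i j : Fin n), i ≠ j →
      0 ≤ fderiv ℝ f x (Pi.single j 1) i) (ξ : Fin n → ℝ) (T : ℝ) (hT : 0 < T) :
    ∃ x : ℝ → (Fin n → ℝ), x 0 = ξ ∧ ∀ t : ℝ, 0 ≤ t → t < T → HasDerivAt x (f (x t)) t := by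
  set M := ‖f ξ‖ with hMdef
  have hM0 : 0 ≤ M := norm_nonneg _
  set R := M * T with hRdef
  have hR : 0 ≤ R := by positivity
  obtain ⟨K, hK⟩ := (hC1.contDiffOn (s := closedBall ξ R)).exists_lipschitzOnWith one_ne_zero
    (convex_closedBall ξ R) (isCompact_closedBall ξ R)
  set g : (Fin n → ℝ) → (Fin n → ℝ) := fun x => f (topicalClamp ξ R x) with hg
  have hgl : LipschitzWith (K * 1) g := by
    rw [← lipschitzOnWith_univ]
    exact hK.comp ((topicalClamp_lipschitz ξ R).lipschitzOnWith)
      (fun x _ => topicalClamp_mem ξ R hR x)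
  obtain ⟨L, hL⟩ := (isCompact_closedBall ξ R).exists_bound_of_continuousOn
    (hC1.continuous.continuousOn (s := closedBall ξ R))
  have hL0 : 0 ≤ L := (norm_nonneg _).trans (hL ξ (mem_closedBall_self hR))
  have h0 : (0 : ℝ) ∈ Icc (-T) T := ⟨by linarith, hT.le⟩
  have hpl : IsPicardLindelof (fun _ => g) (tmin := -T) (tmax := T) ⟨0, h0⟩ ξ
      (⟨L * T, by positivity⟩) 0 ⟨L, hL0⟩ (K * 1) := by
    apply IsPicardLindelof.of_time_independent
    · intro x _
      exact hL _ (topicalClamp_mem ξ R hR x)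
    · exact hgl.lipschitzOnWith
    · simp
      exact le_rfl
  obtain ⟨x, hx0, hx⟩ := hpl.exists_eq_forall_mem_Icc_hasDerivWithinAt₀
  simp only at hx0
  have hxd : ∀ t ∈ Ioo (-T) T, HasDerivAt x (g (x t)) t := fun t ht =>
    (hx t (Ioo_subset_Icc_self ht)).hasDerivAt (Icc_mem_nhds ht.1 ht.2)
  have hxc : ContinuousOn x (Icc 0 T) := fun t ht =>
    ((hx t ⟨by linarith [ht.1], ht.2⟩).continuousWithinAt).mono
      (Icc_subset_Icc (by linarith) le_rfl)
  have hbd : ∀ ⦃t⦄, t ∈ Icc 0 T → ‖x t - ξ‖ ≤ M * t := by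
    refine image_le_of_liminf_slope_right_le_deriv_boundary (f := fun t => ‖x t - ξ‖)
      (B := fun t => M * t) (B' := fun _ => M) ?_ ?_ ?_ ?_ ?_
    · exact (hxc.sub continuousOn_const).norm
    · simp [hx0]
    · fun_prop
    · intro t _
      simpa using ((hasDerivAt_id t).const_mul M).hasDerivWithinAt
    · intro t ht r hr
      have hr0 : 0 < r := hM0.trans_lt hr
      have hd := hasDerivAt_pi.1 (hxd t ⟨by linarith [ht.1], ht.2⟩)
      have hN : ∀ i, |x t i - ξ i| ≤ ‖x t - ξ‖ := fun i => by
        simpa using norm_le_pi_norm (x t - ξ) i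
      have hfM : ∀ i, |f ξ i| ≤ M := fun i => by
        simpa using norm_le_pi_norm (f ξ) i
      have hup : ∀ i, ∀ᶠ z in 𝓝[>] t, x z i - ξ i < ‖x t - ξ‖ + r * (z - t) := fun i =>
        topical_scalar ((hd i).sub_const (ξ i)) ((le_abs_self _).trans (hN i))
          (fun h => (topical_upper n f hC1 hph hMetzler ξ (x t) R i (fun j => by
            rw [h]; exact (le_abs_self _).trans (hN j))).trans
            ((le_abs_self _).trans (hfM i))) hr hr0.le
      have hlo : ∀ i, ∀ᶠ z in 𝓝[>] t, -(x z i - ξ i) < ‖x t - ξ‖ + r * (z - t) := fun i =>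
        topical_scalar ((hd i).sub_const (ξ i)).neg ((neg_le_abs _).trans (hN i))
          (fun h => (neg_le_neg (topical_lower n f hC1 hph hMetzler ξ (x t) R i (fun j => by
            have := (neg_le_abs _).trans (hN j)
            have h' : -(x t i - ξ i) = ‖x t - ξ‖ := h
            linarith))).trans
            ((neg_le_abs _).trans (hfM i))) hr hr0.le
      apply Eventually.frequently
      filter_upwards [eventually_all.2 hup, eventually_all.2 hlo, self_mem_nhdsWithin]
        with z h1 h2 hz
      have hz' : 0 < z - t := sub_pos.2 hz
      rw [slope_def_field, div_lt_iff₀ hz']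
      have : ‖x z - ξ‖ < ‖x t - ξ‖ + r * (z - t) := by
        rw [pi_norm_lt_iff (by positivity)]
        intro i
        rw [Pi.sub_apply, Real.norm_eq_abs, abs_lt]
        constructor <;> linarith [h1 i, h2 i]
      linarith
  refine ⟨x, hx0, fun t ht0 htT => ?_⟩
  have h1 := hxd t ⟨by linarith, htT⟩
  have h2 : topicalClamp ξ R (x t) = x t := by
    apply topicalClamp_of_mem ξ R hR
    rw [mem_closedBall, dist_eq_norm]
    exact (hbd ⟨ht0, htT.le⟩).trans (by rw [hRdef]; gcongr)
  simpa only [hg, h2] using h1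

theorem topical_unique (n : ℕ) (f : (Fin n → ℝ) → (Fin n → ℝ))
    (hC1 : ContDiff ℝ 1 f) (x y : ℝ → (Fin n → ℝ)) (h0 : x 0 = y 0) (T : ℝ)
    (hx : ∀ t : ℝ, 0 ≤ t → t < T → HasDerivAt x (f (x t)) t)
    (hy : ∀ t : ℝ, 0 ≤ t → t < T → HasDerivAt y (f (y t)) t)
    (t : ℝ) (ht : 0 ≤ t) (htT : t < T) : x t = y t := by
  have hxc : ContinuousOn x (Icc 0 t) := fun s hs =>
    (hx s hs.1 (hs.2.trans_lt htT)).continuousAt.continuousWithinAt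
  have hyc : ContinuousOn y (Icc 0 t) := fun s hs =>
    (hy s hs.1 (hs.2.trans_lt htT)).continuousAt.continuousWithinAt
  obtain ⟨A, hA⟩ := isCompact_Icc.exists_bound_of_continuousOn hxc
  obtain ⟨B, hB⟩ := isCompact_Icc.exists_bound_of_continuousOn hyc
  obtain ⟨K, hK⟩ := (hC1.contDiffOn (s := closedBall 0 (max A B))).exists_lipschitzOnWith
    one_ne_zero (convex_closedBall 0 _) (isCompact_closedBall 0 _)
  refine ODE_solution_unique_of_mem_Icc_right (v := fun _ => f)
    (s := fun _ => closedBall 0 (max A B)) (K := K) (a := 0) (b := t) (fun _ _ => hK) hxc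
    (fun s hs => (hx s hs.1 (hs.2.trans htT)).hasDerivWithinAt) ?_ hyc
    (fun s hs => (hy s hs.1 (hs.2.trans htT)).hasDerivWithinAt) ?_ h0 ⟨ht, le_rfl⟩
  · intro s hs
    rw [mem_closedBall_zero_iff]
    exact (hA s ⟨hs.1, hs.2.le⟩).trans (le_max_left _ _)
  · intro s hs
    rw [mem_closedBall_zero_iff]
    exact (hB s ⟨hs.1, hs.2.le⟩).trans (le_max_right _ _)

/-- If `f : ℝⁿ → ℝⁿ` is `C¹`, translation invariant (`f (x + α𝟏) = f x`) and has a
Metzler Jacobian (`∂fᵢ/∂xⱼ ≥ 0` for `i ≠ j`), then for every initial condition `ξ` the solution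
of `ẋ = f(x)` with `x(0) = ξ` exists globally forward in time and is unique (on `t ≥ 0`). -/
theorem topical_ct_global_existence_uniqueness
    (n : ℕ) (f : (Fin n → ℝ) → (Fin n → ℝ))
    (hC1 : ContDiff ℝ 1 f)
    (hph : ∀ (x : Fin n → ℝ) (α : ℝ), f (x + α • (1 : Fin n → ℝ)) = f x)
    (hMetzler : ∀ (x : Fin n → ℝ) (i j : Fin n), i ≠ j →
      0 ≤ fderiv ℝ f x (Pi.single j 1) i) :
    ∀ ξ : Fin n → ℝ, ∃ x : ℝ → (Fin n → ℝ),
      (x 0 = ξ ∧ ∀ t : ℝ, 0 ≤ t → HasDerivAt x (f (x t)) t) ∧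
      ∀ y : ℝ → (Fin n → ℝ),
        (y 0 = ξ ∧ ∀ t : ℝ, 0 ≤ t → HasDerivAt y (f (y t)) t) →
        ∀ t : ℝ, 0 ≤ t → y t = x t := by
  intro ξ
  choose X hX0 hX using fun N : ℕ =>
    topical_finite n f hC1 hph hMetzler ξ ((N : ℝ) + 1) (by positivity)
  have hfl : ∀ t : ℝ, t < (⌊t⌋₊ : ℝ) + 1 := fun t => Nat.lt_floor_add_one t
  have key : ∀ (N : ℕ) (t : ℝ), 0 ≤ t → t < (N : ℝ) + 1 → X ⌊t⌋₊ t = X N t := by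
    intro N t ht htN
    refine topical_unique n f hC1 (X ⌊t⌋₊) (X N) ((hX0 _).trans (hX0 _).symm)
      (min ((⌊t⌋₊ : ℝ) + 1) ((N : ℝ) + 1)) (fun s hs hs' => hX _ s hs (lt_min_iff.1 hs').1)
      (fun s hs hs' => hX _ s hs (lt_min_iff.1 hs').2) t ht (lt_min (hfl t) htN)
  refine ⟨fun t => X ⌊t⌋₊ t, ⟨by simp [hX0], ?_⟩, ?_⟩
  · intro t ht
    refine (hX ⌊t⌋₊ t ht (hfl t)).congr_of_eventuallyEq ?_
    rcases ht.eq_or_lt with h | h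
    · subst h
      filter_upwards [gt_mem_nhds (zero_lt_one (α := ℝ))] with z hz
      have hz0 : ⌊z⌋₊ = 0 := Nat.floor_eq_zero.2 hz
      simp [hz0]
    · filter_upwards [lt_mem_nhds h, gt_mem_nhds (hfl t)] with z hz hz'
      exact key _ z hz.le hz'
  · rintro y ⟨hy0, hy⟩ t ht
    exact topical_unique n f hC1 y (X ⌊t⌋₊) (hy0.trans (hX0 _).symm) ((⌊t⌋₊ : ℝ) + 1)
      (fun s hs _ => hy s hs) (hX _) t ht (hfl t)
end

section
/- Let f : ℝⁿ → ℝⁿ be continuously differentiable with ∂f_i/∂x_j(x) ≥ 0 for all i ≠ j and all x, and with f(x + α𝟏) = f(x) for all x ∈ ℝⁿ and α ∈ ℝ. Let x : [0,∞) → ℝⁿ be differentiable with x'(t) = f(x(t)) for all t ≥ 0, fix T > 0, and suppose the sampled sequence (x(kT))_{k∈ℕ} converges to some L ∈ ℝⁿ as k → ∞. Then the continuous trajectory also converges: x(t) → L as t → ∞. -/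
open Filter

lemma aux_field (n : ℕ) (f : (Fin n → ℝ) → (Fin n → ℝ))
    (hC1 : ContDiff ℝ 1 f)
    (hMetzler : ∀ (x : Fin n → ℝ) (i j : Fin n), i ≠ j →
      0 ≤ fderiv ℝ f x (Pi.single j 1) i)
    (hph : ∀ (x : Fin n → ℝ) (α : ℝ), f (x + α • (1 : Fin n → ℝ)) = f x)
    (a b : Fin n → ℝ) (m : ℝ) (hm : ∀ j, m ≤ b j - a j) (i : Fin n) :
    ∃ ξ ∈ segment ℝ a b, -‖fderiv ℝ f ξ‖ * (b i - a i - m) ≤ f b i - f a i := by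
  have hd : Differentiable ℝ f := hC1.differentiable (by norm_num)
  have hone : ∀ ξ, fderiv ℝ f ξ (1 : Fin n → ℝ) = 0 := by
    intro ξ
    have h1 : HasDerivAt (fun s : ℝ => ξ + s • (1 : Fin n → ℝ)) ((1 : ℝ) • (1 : Fin n → ℝ)) 0 :=
      ((hasDerivAt_id (0 : ℝ)).smul_const (1 : Fin n → ℝ)).const_add ξ
    have h2 : HasFDerivAt f (fderiv ℝ f ξ) (ξ + (0 : ℝ) • (1 : Fin n → ℝ)) := by
      simpa using (hd ξ).hasFDerivAt
    have h3 := h2.comp_hasDerivAt (0 : ℝ) h1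
    have h4 : (f ∘ fun s : ℝ => ξ + s • (1 : Fin n → ℝ)) = fun _ => f ξ := by
      funext s; exact hph ξ s
    rw [h4] at h3
    simpa using h3.unique (hasDerivAt_const _ _)
  have hmv : ∃ ξ ∈ segment ℝ a b, f b i - f a i = fderiv ℝ f ξ (b - a) i := by
    have := domain_mvt (f := fun z => f z i) (s := Set.univ)
      (f' := fun z => (ContinuousLinearMap.proj (R := ℝ) (φ := fun _ : Fin n => ℝ) i).comp (fderiv ℝ f z))
      (fun z _ => ((hasFDerivAt_pi'.1 (hd z).hasFDerivAt) i).hasFDerivWithinAt)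
      convex_univ (Set.mem_univ a) (Set.mem_univ b)
    simpa using this
  obtain ⟨ξ, hξ, h⟩ := hmv
  refine ⟨ξ, hξ, ?_⟩
  rw [h]
  have h5 : fderiv ℝ f ξ (b - a) = fderiv ℝ f ξ (b - a - m • 1) := by
    simp [map_sub, map_smul, hone]
  set v : Fin n → ℝ := b - a - m • 1 with hv
  have hv0 : ∀ j, 0 ≤ v j := by intro j; simp [hv]; linarith [hm j]
  have h6 : fderiv ℝ f ξ v i = ∑ j, v j * fderiv ℝ f ξ (Pi.single j 1) i := by
    conv_lhs => rw [pi_eq_sum_univ' v]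
    simp [map_sum, map_smul, Finset.sum_apply]
  have h7 : v i * fderiv ℝ f ξ (Pi.single i 1) i ≤ ∑ j, v j * fderiv ℝ f ξ (Pi.single j 1) i := by
    rw [← Finset.add_sum_erase _ _ (Finset.mem_univ i)]
    have : 0 ≤ ∑ j ∈ Finset.univ.erase i, v j * fderiv ℝ f ξ (Pi.single j 1) i :=
      Finset.sum_nonneg fun j hj => mul_nonneg (hv0 j) (hMetzler ξ i j (Finset.ne_of_mem_erase hj).symm)
    linarith
  have h8 : |fderiv ℝ f ξ (Pi.single i 1) i| ≤ ‖fderiv ℝ f ξ‖ := by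
    have e1 := norm_le_pi_norm (fderiv ℝ f ξ (Pi.single i 1)) i
    have e2 := (fderiv ℝ f ξ).le_opNorm (Pi.single i 1)
    have e3 : ‖(Pi.single i 1 : Fin n → ℝ)‖ = 1 := by rw [Pi.norm_single, norm_one]
    rw [e3, mul_one] at e2
    exact e1.trans e2
  have h9 : b i - a i - m = v i := by simp [hv]
  rw [h5, h6, h9]
  have := (abs_le.1 h8).1
  nlinarith [hv0 i]

lemma aux_cmp (n : ℕ) (f : (Fin n → ℝ) → (Fin n → ℝ))
    (hf : ∀ (a b : Fin n → ℝ) (m : ℝ), (∀ j, m ≤ b j - a j) → ∀ i,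
      ∃ ξ ∈ segment ℝ a b, -‖fderiv ℝ f ξ‖ * (b i - a i - m) ≤ f b i - f a i)
    (a b : ℝ → (Fin n → ℝ))
    (ha : ∀ t : ℝ, 0 ≤ t → HasDerivAt a (f (a t)) t)
    (hb : ∀ t : ℝ, 0 ≤ t → HasDerivAt b (f (b t)) t)
    (m : ℝ) (h0 : ∀ j, m ≤ b 0 j - a 0 j) (t : ℝ) (ht : 0 ≤ t) (j : Fin n) :
    m ≤ b t j - a t j := by
  have key : ∀ ε > 0, m - ε * t ≤ b t j - a t j := by
    intro ε hε
    let s : Set ℝ := {u | ∀ i, m - ε * u ≤ b u i - a u i}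
    have hca : ContinuousOn a (Set.Icc 0 t) := fun u hu =>
      (ha u hu.1).continuousAt.continuousWithinAt
    have hcb : ContinuousOn b (Set.Icc 0 t) := fun u hu =>
      (hb u hu.1).continuousAt.continuousWithinAt
    have hcl : IsClosed (s ∩ Set.Icc 0 t) := by
      have : s ∩ Set.Icc 0 t = Set.Icc 0 t ∩
          (fun u => fun i => b u i - a u i - (m - ε * u)) ⁻¹' (Set.Ici (0 : Fin n → ℝ)) := by
        ext u
        simp [s, Pi.le_def, and_comm]
      rw [this]
      refine ContinuousOn.preimage_isClosed_of_isClosed ?_ isClosed_Icc isClosed_Ici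
      fun_prop
    have hsub := hcl.Icc_subset_of_forall_mem_nhdsWithin (a := 0) (b := t)
      (by intro i; simpa using h0 i) ?_
    · exact hsub ⟨ht, le_refl t⟩ j
    · rintro u ⟨hus, hu0, hut⟩
      have : ∀ i, ∀ᶠ r in nhdsWithin u (Set.Ioi u), m - ε * r ≤ b r i - a r i := by
        intro i
        have hg : HasDerivAt (fun r => b r i - a r i - (m - ε * r))
            (f (b u) i - f (a u) i + ε) u := by
          have h1 := (hasDerivAt_pi.1 (hb u hu0)) i
          have h2 := (hasDerivAt_pi.1 (ha u hu0)) i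
          have h3 := (h1.sub h2).sub (((hasDerivAt_id u).const_mul ε).const_sub m)
          refine HasDerivAt.congr_deriv h3 ?_
          ring
        rcases (hus i).lt_or_eq with hlt | heq
        · have := hg.continuousAt.eventually (lt_mem_nhds (show 0 < b u i - a u i - (m - ε * u) by linarith))
          filter_upwards [nhdsWithin_le_nhds this] with r hr
          linarith
        · obtain ⟨ξ, -, hξ⟩ := hf (a u) (b u) (m - ε * u) hus i
          rw [← heq] at hξ
          have hpos : 0 < f (b u) i - f (a u) i + ε := by
            have : -‖fderiv ℝ f ξ‖ * (m - ε * u - (m - ε * u)) = 0 := by ring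
            linarith
          have hsl := (hasDerivAt_iff_tendsto_slope.1 hg).eventually (lt_mem_nhds hpos)
          have hsl' : ∀ᶠ r in nhdsWithin u (Set.Ioi u), 0 < slope (fun r => b r i - a r i - (m - ε * r)) u r :=
            hsl.filter_mono (nhdsWithin_mono _ (fun r hr => ne_of_gt hr))
          filter_upwards [hsl', self_mem_nhdsWithin] with r hr hru
          rw [slope_def_field] at hr
          have hru' : 0 < r - u := sub_pos.2 hru
          have := (div_pos_iff_of_pos_right hru').1 hr
          linarith
      exact eventually_all.2 this
  have hlim : Tendsto (fun ε : ℝ => m - ε * t) (nhdsWithin 0 (Set.Ioi 0)) (nhds m) := by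
    have : Continuous (fun ε : ℝ => m - ε * t) := by fun_prop
    simpa using (this.tendsto 0).mono_left nhdsWithin_le_nhds
  exact le_of_tendsto hlim (by filter_upwards [self_mem_nhdsWithin] with ε hε using key ε hε)

lemma aux_strict (n : ℕ) (f : (Fin n → ℝ) → (Fin n → ℝ))
    (hf : ∀ (a b : Fin n → ℝ) (m : ℝ), (∀ j, m ≤ b j - a j) → ∀ i,
      ∃ ξ ∈ segment ℝ a b, -‖fderiv ℝ f ξ‖ * (b i - a i - m) ≤ f b i - f a i)
    (R C : ℝ) (hC : ∀ ξ ∈ Metric.closedBall (0 : Fin n → ℝ) R, ‖fderiv ℝ f ξ‖ ≤ C)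
    (a b : ℝ → (Fin n → ℝ))
    (ha : ∀ t : ℝ, 0 ≤ t → HasDerivAt a (f (a t)) t)
    (hb : ∀ t : ℝ, 0 ≤ t → HasDerivAt b (f (b t)) t)
    (haR : ∀ t : ℝ, 0 ≤ t → a t ∈ Metric.closedBall (0 : Fin n → ℝ) R)
    (hbR : ∀ t : ℝ, 0 ≤ t → b t ∈ Metric.closedBall (0 : Fin n → ℝ) R)
    (m : ℝ) (h0 : ∀ j, m ≤ b 0 j - a 0 j) (t : ℝ) (ht : 0 ≤ t) (i : Fin n) :
    (b 0 i - a 0 i - m) ≤ Real.exp (C * t) * (b t i - a t i - m) := by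
  have hg : ∀ u, 0 ≤ u → HasDerivAt (fun r => Real.exp (C * r) * (b r i - a r i - m))
      (Real.exp (C * u) * (C * (b u i - a u i - m) + (f (b u) i - f (a u) i))) u := by
    intro u hu
    have h1 := (hasDerivAt_pi.1 (hb u hu)) i
    have h2 := (hasDerivAt_pi.1 (ha u hu)) i
    have h3 := ((hasDerivAt_id u).const_mul C).exp.mul ((h1.sub h2).sub_const m)
    refine HasDerivAt.congr_deriv h3 ?_
    simp only [id, Pi.sub_apply]
    ring
  have hmono : MonotoneOn (fun r => Real.exp (C * r) * (b r i - a r i - m)) (Set.Ici 0) := by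
    refine monotoneOn_of_deriv_nonneg (convex_Ici 0)
      (fun u hu => (hg u hu).continuousAt.continuousWithinAt) ?_ ?_
    · intro u hu
      rw [interior_Ici] at hu
      exact (hg u (le_of_lt hu)).differentiableAt.differentiableWithinAt
    · intro u hu
      rw [interior_Ici] at hu
      have hu' : (0 : ℝ) ≤ u := le_of_lt hu
      rw [(hg u hu').deriv]
      refine mul_nonneg (Real.exp_pos _).le ?_
      have hw := aux_cmp n f hf a b ha hb m h0 u hu'
      obtain ⟨ξ, hξ, h⟩ := hf (a u) (b u) m hw i
      have := hC ξ ((convex_closedBall _ _).segment_subset (haR u hu') (hbR u hu') hξ)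
      nlinarith [hw i]
  simpa using hmono (Set.mem_Ici.2 le_rfl) (Set.mem_Ici.2 ht) ht

lemma aux_nonexp (n : ℕ) (f : (Fin n → ℝ) → (Fin n → ℝ))
    (hf : ∀ (a b : Fin n → ℝ) (m : ℝ), (∀ j, m ≤ b j - a j) → ∀ i,
      ∃ ξ ∈ segment ℝ a b, -‖fderiv ℝ f ξ‖ * (b i - a i - m) ≤ f b i - f a i)
    (a b : ℝ → (Fin n → ℝ))
    (ha : ∀ t : ℝ, 0 ≤ t → HasDerivAt a (f (a t)) t)
    (hb : ∀ t : ℝ, 0 ≤ t → HasDerivAt b (f (b t)) t)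
    (t : ℝ) (ht : 0 ≤ t) : dist (a t) (b t) ≤ dist (a 0) (b 0) := by
  refine (dist_pi_le_iff dist_nonneg).2 fun i => ?_
  have key : ∀ j, |a 0 j - b 0 j| ≤ dist (a 0) (b 0) := fun j => dist_le_pi_dist (a 0) (b 0) j
  have h1 := aux_cmp n f hf a b ha hb (-dist (a 0) (b 0))
    (fun j => by linarith [(abs_le.1 (key j)).2]) t ht i
  have h2 := aux_cmp n f hf b a hb ha (-dist (a 0) (b 0))
    (fun j => by linarith [(abs_le.1 (key j)).1]) t ht i
  rw [Real.dist_eq, abs_le]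
  constructor <;> linarith

/-- Rigidity of a periodic limit trajectory. -/
lemma aux_periodic (n : ℕ) (T C R : ℝ) (hT : 0 < T) (y : ℝ → (Fin n → ℝ))
    (hR : ∀ t, 0 ≤ t → ∀ i, |y t i| ≤ R)
    (hper : ∀ t, 0 ≤ t → y (t + T) = y t)
    (hst : ∀ t₀ h t : ℝ, 0 ≤ t₀ → 0 ≤ h → 0 ≤ t → ∀ m : ℝ,
      (∀ j, m ≤ y (t₀ + h) j - y t₀ j) → ∀ i,
      y (t₀ + h) i - y t₀ i - m ≤ Real.exp (C * t) * (y (t₀ + t + h) i - y (t₀ + t) i - m))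
    (s : ℝ) (hs : 0 ≤ s) : y s = y 0 := by
  have hperk : ∀ k : ℕ, ∀ t, 0 ≤ t → y (t + k * T) = y t := by
    intro k
    induction k with
    | zero => intro t _; simp
    | succ k ih =>
      intro t ht
      have : t + ((k + 1 : ℕ) : ℝ) * T = (t + k * T) + T := by push_cast; ring
      rw [this, hper _ (by positivity), ih t ht]
  have hmono : ∀ t h : ℝ, 0 ≤ t → 0 ≤ h → ∀ j, y t j ≤ y (t + h) j := by
    intro t h ht hh j
    have : Nonempty (Fin n) := ⟨j⟩
    obtain ⟨i₀, hi₀⟩ := Finite.exists_min (fun i => y h i - y 0 i)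
    set m := y h i₀ - y 0 i₀ with hm
    have hw : ∀ t, 0 ≤ t → ∀ i, m ≤ y (t + h) i - y t i := by
      intro t ht i
      have h1 := hst 0 h t le_rfl hh ht m (by simpa using hi₀) i
      have h2 := hi₀ i
      simp only [zero_add] at h1
      have h3 : 0 ≤ Real.exp (C * t) * (y (t + h) i - y t i - m) := by linarith
      have := nonneg_of_mul_nonneg_right h3 (Real.exp_pos _)
      linarith
    have hex : ∃ i, ∀ t, 0 ≤ t → y (t + h) i - y t i = m := by
      by_contra! hcon
      choose τ hτ0 hτ using hcon
      obtain ⟨N, hN⟩ := exists_nat_ge (τ i₀ / T)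
      have hN' : τ i₀ ≤ N * T := (div_le_iff₀ hT).1 hN
      have h1 := hst (τ i₀) h (N * T - τ i₀) (hτ0 _) hh (by linarith) m (hw _ (hτ0 _)) i₀
      have h2 : m < y (τ i₀ + h) i₀ - y (τ i₀) i₀ :=
        lt_of_le_of_ne (hw _ (hτ0 _) i₀) (hτ i₀).symm
      have e1 : τ i₀ + (N * T - τ i₀) = 0 + N * T := by ring
      have e2 : τ i₀ + (N * T - τ i₀) + h = h + N * T := by ring
      rw [e2, e1, hperk N h hh, hperk N 0 le_rfl] at h1
      have : y h i₀ - y 0 i₀ - m = 0 := by rw [hm]; ring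
      rw [this] at h1
      linarith
    obtain ⟨i, hi⟩ := hex
    have hk : ∀ k : ℕ, y (k * h) i = y 0 i + k * m := by
      intro k
      induction k with
      | zero => simp
      | succ k ih =>
        have e := hi (k * h) (by positivity)
        have : ((k + 1 : ℕ) : ℝ) * h = k * h + h := by push_cast; ring
        rw [this]
        push_cast
        linarith
    have hm0 : m = 0 := by
      by_contra hne
      have hpos : 0 < |m| := abs_pos.2 hne
      obtain ⟨k, hk'⟩ := exists_nat_gt ((2 * R) / |m|)
      have h1 : 2 * R < k * |m| := (div_lt_iff₀ hpos).1 hk'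
      have h2 : (k : ℝ) * m = y (k * h) i - y 0 i := by rw [hk k]; ring
      have h3 : |(k : ℝ) * m| ≤ 2 * R := by
        rw [h2]
        have := abs_sub (y (k * h) i) (y 0 i)
        have := hR (k * h) (by positivity) i
        have := hR 0 le_rfl i
        linarith
      rw [abs_mul, Nat.abs_cast] at h3
      linarith
    have := hw t ht j
    linarith
  funext j
  obtain ⟨N, hN⟩ := exists_nat_ge (s / T)
  have hN' : s ≤ N * T := (div_le_iff₀ hT).1 hN
  have h1 := hmono 0 s le_rfl hs j
  have h2 := hmono s (N * T - s) hs (by linarith) j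
  have e1 : s + (N * T - s) = 0 + N * T := by ring
  rw [e1, hperk N 0 le_rfl] at h2
  rw [zero_add] at h1
  linarith

theorem sampled_convergence_implies_continuous_convergence
    (n : ℕ) (f : (Fin n → ℝ) → (Fin n → ℝ))
    (hC1 : ContDiff ℝ 1 f)
    (hMetzler : ∀ (x : Fin n → ℝ) (i j : Fin n), i ≠ j →
      0 ≤ fderiv ℝ f x (Pi.single j 1) i)
    (hph : ∀ (x : Fin n → ℝ) (α : ℝ), f (x + α • (1 : Fin n → ℝ)) = f x)
    (x : ℝ → (Fin n → ℝ))
    (hsol : ∀ t : ℝ, 0 ≤ t → HasDerivAt x (f (x t)) t)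
    (T : ℝ) (hT : 0 < T) (L : Fin n → ℝ)
    (hsample : Tendsto (fun k : ℕ => x (k * T)) atTop (nhds L)) :
    Tendsto x atTop (nhds L) := by
  have hf := aux_field n f hC1 hMetzler hph
  have hshift : ∀ c, 0 ≤ c → ∀ t : ℝ, 0 ≤ t →
      HasDerivAt (fun r => x (c + r)) (f (x (c + t))) t := by
    intro c hc t ht
    exact (hsol (c + t) (by linarith)).comp_const_add c t
  have hne : ∀ c d t : ℝ, 0 ≤ c → 0 ≤ d → 0 ≤ t → dist (x (c + t)) (x (d + t)) ≤ dist (x c) (x d) := by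
    intro c d t hc hd ht
    simpa using aux_nonexp n f hf (fun r => x (c + r)) (fun r => x (d + r))
      (hshift c hc) (hshift d hd) t ht
  have hdec : ∀ t, 0 ≤ t → ∃ k : ℕ, ∃ s, 0 ≤ s ∧ s ≤ T ∧ t = k * T + s ∧ t / T < k + 1 := by
    intro t ht
    refine ⟨⌊t / T⌋₊, t - ⌊t / T⌋₊ * T, ?_, ?_, by ring, Nat.lt_floor_add_one _⟩
    · have := (le_div_iff₀ hT).1 (Nat.floor_le (div_nonneg ht hT.le))
      linarith
    · have := (div_lt_iff₀ hT).1 (Nat.lt_floor_add_one (t / T))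
      linarith
  -- boundedness
  have hbdd : ∃ R, ∀ t, 0 ≤ t → x t ∈ Metric.closedBall (0 : Fin n → ℝ) R := by
    have hcont : ContinuousOn x (Set.Icc 0 T) := fun u hu =>
      (hsol u hu.1).continuousAt.continuousWithinAt
    obtain ⟨R₁, hR₁⟩ := (isCompact_Icc.image_of_continuousOn hcont).isBounded.subset_closedBall 0
    obtain ⟨R₂, hR₂⟩ := (Metric.isBounded_range_of_tendsto _ hsample).subset_closedBall (x 0)
    refine ⟨R₁ + R₂, fun t ht => ?_⟩
    obtain ⟨k, s, hs0, hsT, rfl, -⟩ := hdec t ht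
    have h1 := hne (k * T) 0 s (by positivity) le_rfl hs0
    have h2 : dist (x (k * T)) (x 0) ≤ R₂ := hR₂ ⟨k, rfl⟩
    have h3 : dist (x s) 0 ≤ R₁ := hR₁ ⟨s, ⟨hs0, hsT⟩, rfl⟩
    rw [zero_add] at h1
    have := dist_triangle (x (k * T + s)) (x s) 0
    rw [Metric.mem_closedBall]
    linarith
  obtain ⟨R, hR⟩ := hbdd
  obtain ⟨C, hC⟩ := (isCompact_closedBall (0 : Fin n → ℝ) R).exists_bound_of_continuousOn
    (hC1.continuous_fderiv (by norm_num)).continuousOn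
  -- the limit trajectory
  have hlim : ∀ s, 0 ≤ s → ∃ l, Tendsto (fun k : ℕ => x (k * T + s)) atTop (nhds l) := by
    intro s hs
    refine cauchySeq_tendsto_of_complete ?_
    have hc := hsample.cauchySeq
    rw [Metric.cauchySeq_iff] at hc ⊢
    intro ε hε
    obtain ⟨N, hN⟩ := hc ε hε
    exact ⟨N, fun p hp q hq =>
      (hne _ _ s (by positivity) (by positivity) hs).trans_lt (hN p hp q hq)⟩
  choose! y hy using hlim
  have hy0 : y 0 = L := tendsto_nhds_unique (by simpa using hy 0 le_rfl) hsample
  have hyc : ∀ s, 0 ≤ s → y s = y 0 := by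
    intro s hs
    refine aux_periodic n T C R hT y ?_ ?_ ?_ s hs
    · intro t ht i
      have : y t ∈ Metric.closedBall (0 : Fin n → ℝ) R :=
        Metric.isClosed_closedBall.mem_of_tendsto (hy t ht)
          (Eventually.of_forall fun k => hR _ (by positivity))
      rw [mem_closedBall_zero_iff] at this
      exact (norm_le_pi_norm (y t) i).trans this
    · intro t ht
      refine tendsto_nhds_unique (hy (t + T) (by linarith)) ?_
      have := (hy t ht).comp (tendsto_add_atTop_nat 1)
      refine this.congr fun k => ?_
      simp only [Function.comp]
      congr 1
      push_cast
      ring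
    · intro t₀ h t ht₀ hh ht m hm i
      have hyj : ∀ s, 0 ≤ s → ∀ j, Tendsto (fun k : ℕ => x (k * T + s) j) atTop (nhds (y s j)) :=
        fun s hs j => (tendsto_pi_nhds.1 (hy s hs)) j
      have key : ∀ ε > 0, y (t₀ + h) i - y t₀ i - (m - ε) ≤
          Real.exp (C * t) * (y (t₀ + t + h) i - y (t₀ + t) i - (m - ε)) := by
        intro ε hε
        have hev : ∀ᶠ k : ℕ in atTop, ∀ j, m - ε ≤ x (k * T + (t₀ + h)) j - x (k * T + t₀) j := by
          refine eventually_all.2 fun j => ?_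
          have := ((hyj (t₀ + h) (by positivity) j).sub (hyj t₀ ht₀ j)).eventually
            (lt_mem_nhds (show m - ε < _ by linarith [hm j]))
          filter_upwards [this] with k hk using hk.le
        refine le_of_tendsto_of_tendsto
          (((hyj (t₀ + h) (by positivity) i).sub (hyj t₀ ht₀ i)).sub_const (m - ε))
          ((((hyj (t₀ + t + h) (by positivity) i).sub
            (hyj (t₀ + t) (by positivity) i)).sub_const (m - ε)).const_mul (Real.exp (C * t))) ?_
        filter_upwards [hev] with k hk
        have h1 := aux_strict n f hf R C hC (fun r => x ((k * T + t₀) + r))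
          (fun r => x ((k * T + (t₀ + h)) + r))
          (hshift _ (by positivity)) (hshift _ (by positivity))
          (fun r hr => hR _ (by positivity)) (fun r hr => hR _ (by positivity)) (m - ε)
          (by simpa using hk) t ht i
        have e1 : (k * T + t₀) + t = k * T + (t₀ + t) := by ring
        have e2 : (k * T + (t₀ + h)) + t = k * T + (t₀ + t + h) := by ring
        simpa only [add_zero, e1, e2] using h1
      refine le_of_tendsto_of_tendsto (b := nhdsWithin (0 : ℝ) (Set.Ioi 0))
        (f := fun ε : ℝ => y (t₀ + h) i - y t₀ i - (m - ε))
        (g := fun ε : ℝ => Real.exp (C * t) * (y (t₀ + t + h) i - y (t₀ + t) i - (m - ε))) ?_ ?_ ?_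
      · have : Continuous (fun ε : ℝ => y (t₀ + h) i - y t₀ i - (m - ε)) := by fun_prop
        simpa using (this.tendsto 0).mono_left nhdsWithin_le_nhds
      · have : Continuous (fun ε : ℝ =>
            Real.exp (C * t) * (y (t₀ + t + h) i - y (t₀ + t) i - (m - ε))) := by fun_prop
        simpa using (this.tendsto 0).mono_left nhdsWithin_le_nhds
      · filter_upwards [self_mem_nhdsWithin] with ε hε using key ε hε
  have hfin : ∀ k : ℕ, ∀ s, 0 ≤ s → dist (x (k * T + s)) L ≤ dist (x (k * T)) L := by
    intro k s hs
    have h1 : Tendsto (fun p : ℕ => x (p * T + s)) atTop (nhds L) := by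
      have := hy s hs
      rwa [hyc s hs, hy0] at this
    exact le_of_tendsto_of_tendsto' (tendsto_const_nhds.dist h1) (tendsto_const_nhds.dist hsample)
      fun p => hne _ _ s (by positivity) (by positivity) hs
  rw [Metric.tendsto_atTop] at hsample ⊢
  intro ε hε
  obtain ⟨N, hN⟩ := hsample ε hε
  refine ⟨N * T, fun t ht => ?_⟩
  have h1 := hfin N (t - N * T) (by linarith)
  rw [show (N : ℝ) * T + (t - N * T) = t by ring] at h1
  exact h1.trans_lt (hN N le_rfl)
end

section
/- Let f : ℝⁿ → ℝⁿ be continuously differentiable with ∂f_i/∂x_j(x) ≥ 0 for all i ≠ j and all x ∈ ℝⁿ. Let T > 0 and let x, z : [0,T] → ℝⁿ be differentiable with x'(t) = f(x(t)) and z'(t) = f(z(t)) for all t ∈ [0,T]. If x(0) ≤ z(0) componentwise, then x(t) ≤ z(t) componentwise for all t ∈ [0,T]. -/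
lemma metzler_aux (n : ℕ) (f : (Fin n → ℝ) → (Fin n → ℝ))
    (hC1 : ContDiff ℝ 1 f)
    (hMetzler : ∀ (x : Fin n → ℝ) (i j : Fin n), i ≠ j →
      0 ≤ fderiv ℝ f x (Pi.single j 1) i)
    (R K : ℝ) (hK : ∀ c ∈ Metric.closedBall (0 : Fin n → ℝ) R, ‖fderiv ℝ f c‖ ≤ K)
    (a b : Fin n → ℝ) (ha : a ∈ Metric.closedBall (0 : Fin n → ℝ) R)
    (hb : b ∈ Metric.closedBall (0 : Fin n → ℝ) R)
    (m : ℝ) (hm : 0 ≤ m) (hd : ∀ j, -m ≤ b j - a j) (i : Fin n) (hi : b i - a i = -m) :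
    -(m * K) ≤ f b i - f a i := by
  have hdiff : Differentiable ℝ f := hC1.differentiable (by norm_num)
  have hg : ∀ s : ℝ, HasDerivAt (fun s : ℝ => f (a + s • (b - a)) i)
      (fderiv ℝ f (a + s • (b - a)) (b - a) i) s := by
    intro s
    have h1 : HasDerivAt (fun s : ℝ => a + s • (b - a)) (b - a) s := by
      simpa using ((hasDerivAt_id s).smul_const (b - a)).const_add a
    have h2 := (hdiff (a + s • (b - a))).hasFDerivAt.comp_hasDerivAt s h1
    exact (hasDerivAt_pi.1 h2) i
  obtain ⟨s, hs, hse⟩ := exists_hasDerivAt_eq_slope (fun s : ℝ => f (a + s • (b - a)) i)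
    (fun s => fderiv ℝ f (a + s • (b - a)) (b - a) i) (zero_lt_one)
    (fun s _ => (hg s).continuousAt.continuousWithinAt) (fun s _ => hg s)
  simp only [one_smul, zero_smul, add_zero, sub_zero, div_one, add_sub_cancel] at hse
  rw [← hse]
  have hc : a + s • (b - a) ∈ Metric.closedBall (0 : Fin n → ℝ) R :=
    (convex_closedBall (0 : Fin n → ℝ) R).add_smul_sub_mem ha hb ⟨hs.1.le, hs.2.le⟩
  generalize a + s • (b - a) = c at hc
  have e : b - a = (∑ j, (b j - a j + m) • Pi.single j (1 : ℝ)) - m • (fun _ => (1 : ℝ)) := by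
    ext k
    simp [Finset.sum_apply, Pi.single_apply]
  have h1 : |fderiv ℝ f c (fun _ => (1 : ℝ)) i| ≤ K := by
    have := norm_le_pi_norm (fderiv ℝ f c (fun _ => (1 : ℝ))) i
    rw [Real.norm_eq_abs] at this
    refine this.trans (((fderiv ℝ f c).le_opNorm _).trans ?_)
    have h3 : ‖(fun _ : Fin n => (1 : ℝ))‖ ≤ 1 := by
      rw [pi_norm_le_iff_of_nonneg zero_le_one]; simp
    calc _ ≤ ‖fderiv ℝ f c‖ * 1 := by gcongr
      _ ≤ K := by simpa using hK c hc
  have h2 : 0 ≤ ∑ j, (b j - a j + m) * fderiv ℝ f c (Pi.single j 1) i := by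
    refine Finset.sum_nonneg fun j _ => ?_
    by_cases hij : i = j
    · subst hij; rw [hi]; simp
    · exact mul_nonneg (by linarith [hd j]) (hMetzler c i j hij)
  rw [e, map_sub, map_sum]
  simp only [map_smul, Pi.sub_apply, Finset.sum_apply, Pi.smul_apply, smul_eq_mul]
  have := mul_le_mul_of_nonneg_left (abs_le.1 h1).2 hm
  linarith

/-- (Kamke comparison) If `f : ℝⁿ → ℝⁿ` is `C¹` with Metzler Jacobian
(`∂fᵢ/∂xⱼ ≥ 0` for `i ≠ j`), and `x, z` are solutions of `ẋ = f(x)` on `[0,T]` with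
`x(0) ≤ z(0)` componentwise, then `x(t) ≤ z(t)` componentwise for all `t ∈ [0,T]`. -/
theorem metzler_implies_monotone_ct
    (n : ℕ) (f : (Fin n → ℝ) → (Fin n → ℝ))
    (hC1 : ContDiff ℝ 1 f)
    (hMetzler : ∀ (x : Fin n → ℝ) (i j : Fin n), i ≠ j →
      0 ≤ fderiv ℝ f x (Pi.single j 1) i)
    (T : ℝ) (hT : 0 < T)
    (x z : ℝ → (Fin n → ℝ))
    (hx : ∀ t ∈ Set.Icc (0 : ℝ) T, HasDerivAt x (f (x t)) t)
    (hz : ∀ t ∈ Set.Icc (0 : ℝ) T, HasDerivAt z (f (z t)) t)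
    (h0 : x 0 ≤ z 0) :
    ∀ t ∈ Set.Icc (0 : ℝ) T, x t ≤ z t := by
  have hxc : ContinuousOn x (Set.Icc 0 T) := fun t ht => (hx t ht).continuousAt.continuousWithinAt
  have hzc : ContinuousOn z (Set.Icc 0 T) := fun t ht => (hz t ht).continuousAt.continuousWithinAt
  obtain ⟨R1, hR1⟩ := isCompact_Icc.exists_bound_of_continuousOn hxc
  obtain ⟨R2, hR2⟩ := isCompact_Icc.exists_bound_of_continuousOn hzc
  obtain ⟨K, hK⟩ := (isCompact_closedBall (0 : Fin n → ℝ) (max R1 R2)).exists_bound_of_continuousOn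
    (hC1.continuous_fderiv (by norm_num)).continuousOn
  have key : ∀ ε > 0, ∀ t ∈ Set.Icc (0 : ℝ) T, ∀ i,
      0 < z t i - x t i + ε * Real.exp ((K + 1) * t) := by
    intro ε hε
    by_contra! hcon
    obtain ⟨t1, ht1, i1, hi1⟩ := hcon
    have hder : ∀ t ∈ Set.Icc (0 : ℝ) T, ∀ i,
        HasDerivAt (fun t => z t i - x t i + ε * Real.exp ((K + 1) * t))
        (f (z t) i - f (x t) i + ε * (Real.exp ((K + 1) * t) * (K + 1))) t := by
      intro t ht i
      have h3 : HasDerivAt (fun t => (K + 1) * t) (K + 1) t := by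
        simpa using (hasDerivAt_id t).const_mul (K + 1)
      exact (((hasDerivAt_pi.1 (hz t ht)) i).sub ((hasDerivAt_pi.1 (hx t ht)) i)).add
        (h3.exp.const_mul ε)
    have hcomp : IsCompact (⋃ i, Set.Icc (0 : ℝ) T ∩
        (fun t => z t i - x t i + ε * Real.exp ((K + 1) * t)) ⁻¹' Set.Iic 0) := by
      refine isCompact_iUnion fun i => ?_
      refine isCompact_Icc.of_isClosed_subset ?_ Set.inter_subset_left
      exact ContinuousOn.preimage_isClosed_of_isClosed
        (fun t ht => (hder t ht i).continuousAt.continuousWithinAt) isClosed_Icc isClosed_Iic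
    obtain ⟨t, htS, htmin⟩ := hcomp.exists_isLeast ⟨t1, Set.mem_iUnion.2 ⟨i1, ht1, hi1⟩⟩
    obtain ⟨i, ht, hi⟩ := Set.mem_iUnion.1 htS
    simp only [Set.mem_preimage, Set.mem_Iic] at hi
    have hpos : ∀ s, 0 ≤ s → s < t → ∀ j, 0 < z s j - x s j + ε * Real.exp ((K + 1) * s) := by
      intro s hs hst j
      by_contra! hc
      exact absurd (htmin (Set.mem_iUnion.2 ⟨j, ⟨hs, hst.le.trans ht.2⟩, hc⟩)) (not_le.2 hst)
    have ht0 : 0 < t := by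
      rcases ht.1.lt_or_eq with h | h
      · exact h
      · subst h
        have := h0 i
        simp at hi
        linarith
    have hev : ∀ᶠ s in nhdsWithin t (Set.Iio t), 0 ≤ s ∧ s < t := by
      filter_upwards [Ioo_mem_nhdsLT ht0] with s hs using ⟨hs.1.le, hs.2⟩
    have hge : ∀ j, 0 ≤ z t j - x t j + ε * Real.exp ((K + 1) * t) := by
      intro j
      have h1 := (hder t ht j).continuousAt.continuousWithinAt (s := Set.Iio t)
      refine ge_of_tendsto h1 ?_
      filter_upwards [hev] with s hs using (hpos s hs.1 hs.2 j).le
    have hi0 := le_antisymm hi (hge i)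
    have hmpos : 0 < ε * Real.exp ((K + 1) * t) := by positivity
    have haux := metzler_aux n f hC1 hMetzler (max R1 R2) K hK (x t) (z t)
      (by simpa using Or.inl (hR1 t ht)) (by simpa using Or.inr (hR2 t ht))
      (ε * Real.exp ((K + 1) * t)) hmpos.le (fun j => by linarith [hge j]) i (by linarith)
    have hdp : 0 < f (z t) i - f (x t) i + ε * (Real.exp ((K + 1) * t) * (K + 1)) := by
      nlinarith
    have hsl := (hasDerivAt_iff_tendsto_slope.1 (hder t ht i)).mono_left
      (nhdsWithin_mono t (show Set.Iio t ⊆ {t}ᶜ from fun s hs => ne_of_lt hs))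
    obtain ⟨s, hs1, hs2⟩ := ((hsl.eventually (lt_mem_nhds hdp)).and hev).exists
    have hps := hpos s hs2.1 hs2.2 i
    rw [slope_def_field] at hs1
    simp only [hi0] at hs1
    have := div_neg_of_pos_of_neg (sub_pos.2 hps) (sub_neg.2 hs2.2)
    linarith
  intro t ht i
  refine le_of_forall_pos_lt_add fun δ hδ => ?_
  have := key (δ / Real.exp ((K + 1) * t)) (by positivity) t ht i
  rw [div_mul_cancel₀ _ (Real.exp_pos _).ne'] at this
  linarith
end

section
/- Let f : ℝⁿ → ℝⁿ be continuously differentiable and suppose that solutions of ẋ = f(x) preserve the componentwise order: for every T > 0 and all differentiable x, z : [0,T] → ℝⁿ with x'(t) = f(x(t)) and z'(t) = f(z(t)) on [0,T], x(0) ≤ z(0) implies x(t) ≤ z(t) for all t ∈ [0,T]. Then the Jacobian of f is Metzler everywhere: ∂f_i/∂x_j(x) ≥ 0 for all i ≠ j and all x ∈ ℝⁿ. -/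
theorem aux_deriv_nonneg (g : ℝ → ℝ) (g' : ℝ) (hg : HasDerivAt g g' 0) (ε : ℝ) (hε : 0 < ε)
    (h : ∀ t, 0 < t → t < ε → g 0 ≤ g t) : 0 ≤ g' := by
  have h1 := hg.tendsto_slope_zero_right
  refine ge_of_tendsto h1 ?_
  filter_upwards [Ioo_mem_nhdsGT hε] with t ht
  have h2 := h t ht.1 ht.2
  have h3 : 0 ≤ t⁻¹ := inv_nonneg.2 ht.1.le
  simp only [zero_add, smul_eq_mul]
  exact mul_nonneg h3 (by linarith)

/-- If `f : ℝⁿ → ℝⁿ` is `C¹` and solutions of `ẋ = f(x)` preserve the componentwise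
order on every interval `[0,T]`, then the Jacobian of `f` is Metzler everywhere. -/
theorem monotone_ct_implies_metzler
    (n : ℕ) (f : (Fin n → ℝ) → (Fin n → ℝ))
    (hC1 : ContDiff ℝ 1 f)
    (hmono : ∀ T : ℝ, 0 < T → ∀ x z : ℝ → (Fin n → ℝ),
      (∀ t ∈ Set.Icc (0 : ℝ) T, HasDerivAt x (f (x t)) t) →
      (∀ t ∈ Set.Icc (0 : ℝ) T, HasDerivAt z (f (z t)) t) →
      x 0 ≤ z 0 → ∀ t ∈ Set.Icc (0 : ℝ) T, x t ≤ z t) :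
    ∀ (x : Fin n → ℝ) (i j : Fin n), i ≠ j →
      0 ≤ fderiv ℝ f x (Pi.single j 1) i := by
  have sol : ∀ p : Fin n → ℝ, ∃ α : ℝ → (Fin n → ℝ), α 0 = p ∧ ∃ ε > (0 : ℝ),
      ∀ t ∈ Set.Ioo (0 - ε) (0 + ε), HasDerivAt α (f (α t)) t := fun p =>
    ContDiffAt.exists_forall_mem_closedBall_exists_eq_forall_mem_Ioo_hasDerivAt₀ (hC1.contDiffAt (x := p)) 0
  have kamke : ∀ (p q : Fin n → ℝ) (i : Fin n), p ≤ q → p i = q i → f p i ≤ f q i := by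
    intro p q i hpq hi
    obtain ⟨a, ha0, e, he, ha⟩ := sol p
    obtain ⟨b, hb0, d, hd, hb⟩ := sol q
    have hT : 0 < min e d / 2 := by positivity
    have hTe : min e d / 2 < e := by have := min_le_left e d; linarith
    have hTd : min e d / 2 < d := by have := min_le_right e d; linarith
    have hm := hmono (min e d / 2) hT a b
      (fun t ht => ha t ⟨by linarith [ht.1], by linarith [ht.2]⟩)
      (fun t ht => hb t ⟨by linarith [ht.1], by linarith [ht.2]⟩)
      (by rw [ha0, hb0]; exact hpq)
    have h1 := hasDerivAt_pi.1 (ha 0 ⟨by linarith, by linarith⟩) i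
    have h2 := hasDerivAt_pi.1 (hb 0 ⟨by linarith, by linarith⟩) i
    have h3 := aux_deriv_nonneg _ _ (h2.sub h1) _ hT (by
      intro t ht1 ht2
      have := hm t ⟨ht1.le, ht2.le⟩ i
      simp only [Pi.sub_apply, ha0, hb0, hi]
      linarith)
    rw [ha0, hb0] at h3
    linarith
  intro x i j hij
  have hd : HasFDerivAt f (fderiv ℝ f x) x :=
    (hC1.differentiable (by norm_num) x).hasFDerivAt
  have hl := hasDerivAt_pi.1 (hd.hasLineDerivAt (Pi.single j 1)) i
  refine aux_deriv_nonneg _ _ hl 1 one_pos ?_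
  intro t ht _
  apply kamke
  · intro k
    by_cases hk : k = j
    · subst hk; simp [ht.le]
    · simp [hk]
  · simp [hij]
end

section
/- Let f : ℝⁿ → ℝⁿ be continuously differentiable with ∂f_i/∂x_j(x) ≥ 0 for all i ≠ j and all x ∈ ℝⁿ. Let T > 0 and let x, z : [0,T] → ℝⁿ be differentiable with x'(t) = f(x(t)) and z'(t) = f(z(t)) for all t ∈ [0,T], and suppose x(0) ≤ z(0) componentwise. Then for every index i with x_i(0) < z_i(0), the strict order is preserved: x_i(t) < z_i(t) for all t ∈ [0,T] (i.e., smooth monotone continuous-time systems are type-K monotone). -/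
/-- At a first zero from above, the derivative cannot be positive. -/
lemma typeK_aux_deriv (g : ℝ → ℝ) (d t : ℝ) (ht : 0 < t) (hg : HasDerivAt g d t)
    (h0 : g t ≤ 0) (hpos : ∀ s, 0 ≤ s → s < t → 0 < g s) : d ≤ 0 := by
  by_contra hd
  push Not at hd
  have h1 := (hasDerivAt_iff_tendsto_slope.1 hg)
  have h2 := h1.mono_left (nhdsWithin_mono t (fun s (hs : s ∈ Set.Iio t) => ne_of_lt hs))
  have h3 := h2.eventually (lt_mem_nhds hd)
  have h4 : ∀ᶠ s in nhdsWithin t (Set.Iio t), s ∈ Set.Ioo 0 t :=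
    Ioo_mem_nhdsLT ht
  obtain ⟨s, hs, hs2⟩ := (h3.and h4).exists
  have h5 := hpos s hs2.1.le hs2.2
  rw [slope_def_field] at hs
  have h6 : (g s - g t) / (s - t) ≤ 0 :=
    div_nonpos_of_nonneg_of_nonpos (by linarith) (by linarith [hs2.2])
  linarith

/-- Expansion of a linear map in coordinates. -/
lemma typeK_aux_expand {n : ℕ} (D : (Fin n → ℝ) →L[ℝ] (Fin n → ℝ)) (v : Fin n → ℝ) (i : Fin n) :
    D v i = ∑ j, v j * D (Pi.single j 1) i := by
  conv_lhs => rw [pi_eq_sum_univ' v]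
  simp [map_sum, Finset.sum_apply]

lemma typeK_aux_mono {n : ℕ} (D : (Fin n → ℝ) →L[ℝ] (Fin n → ℝ)) (u v : Fin n → ℝ) (i : Fin n)
    (hD : ∀ j, i ≠ j → 0 ≤ D (Pi.single j 1) i) (hi : u i = v i) (huv : u ≤ v) :
    D u i ≤ D v i := by
  rw [typeK_aux_expand, typeK_aux_expand]
  refine Finset.sum_le_sum fun j _ => ?_
  by_cases h : i = j
  · subst h; rw [hi]
  · exact mul_le_mul_of_nonneg_right (huv j) (hD j h)

lemma typeK_aux_bound {n : ℕ} (D : (Fin n → ℝ) →L[ℝ] (Fin n → ℝ)) (L m : ℝ) (u : Fin n → ℝ)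
    (hL : ‖D‖ ≤ L) (hu : ‖u‖ ≤ m) (i : Fin n) : |D u i| ≤ L * m := by
  have h1 : ‖D u i‖ ≤ ‖D u‖ := norm_le_pi_norm _ i
  rw [Real.norm_eq_abs] at h1
  refine h1.trans ((D.le_opNorm u).trans ?_)
  exact mul_le_mul hL hu (norm_nonneg _) ((norm_nonneg _).trans hL)

/-- Smooth monotone continuous-time systems are type-K monotone: if `f : ℝⁿ → ℝⁿ`
is `C¹` with Metzler Jacobian, and `x, z` are solutions of `ẋ = f(x)` on `[0,T]` with
`x(0) ≤ z(0)`, then strict order in any coordinate of the initial conditions is preserved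
in that coordinate along the solutions. -/
theorem smooth_monotone_ct_is_typeK
    (n : ℕ) (f : (Fin n → ℝ) → (Fin n → ℝ))
    (hC1 : ContDiff ℝ 1 f)
    (hMetzler : ∀ (x : Fin n → ℝ) (i j : Fin n), i ≠ j →
      0 ≤ fderiv ℝ f x (Pi.single j 1) i)
    (T : ℝ) (hT : 0 < T)
    (x z : ℝ → (Fin n → ℝ))
    (hx : ∀ t ∈ Set.Icc (0 : ℝ) T, HasDerivAt x (f (x t)) t)
    (hz : ∀ t ∈ Set.Icc (0 : ℝ) T, HasDerivAt z (f (z t)) t)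
    (h0 : x 0 ≤ z 0) :
    ∀ i : Fin n, x 0 i < z 0 i → ∀ t ∈ Set.Icc (0 : ℝ) T, x t i < z t i := by
  -- a uniform bound on the Jacobian
  have hxc : ContinuousOn x (Set.Icc 0 T) := fun t ht => (hx t ht).continuousAt.continuousWithinAt
  have hzc : ContinuousOn z (Set.Icc 0 T) := fun t ht => (hz t ht).continuousAt.continuousWithinAt
  obtain ⟨R1, hR1⟩ := isCompact_Icc.exists_bound_of_continuousOn hxc
  obtain ⟨R2, hR2⟩ := isCompact_Icc.exists_bound_of_continuousOn hzc
  obtain ⟨L, hL⟩ := (isCompact_closedBall (0 : Fin n → ℝ) (max R1 R2)).exists_bound_of_continuousOn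
    (hC1.continuous_fderiv one_ne_zero).continuousOn
  have key : ∀ t ∈ Set.Icc 0 T, ∀ i, ∃ D : (Fin n → ℝ) →L[ℝ] (Fin n → ℝ), ‖D‖ ≤ L ∧
      (∀ j, i ≠ j → 0 ≤ D (Pi.single j 1) i) ∧ f (z t) i - f (x t) i = D (z t - x t) i := by
    intro t ht i
    have hxm : x t ∈ Metric.closedBall (0 : Fin n → ℝ) (max R1 R2) := by
      simpa using (hR1 t ht).trans (le_max_left _ _) |> le_max_iff.1
    have hzm : z t ∈ Metric.closedBall (0 : Fin n → ℝ) (max R1 R2) := by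
      simpa using (hR2 t ht).trans (le_max_right _ _) |> le_max_iff.1
    have hcv := convex_closedBall (0 : Fin n → ℝ) (max R1 R2)
    obtain ⟨c, hc, he⟩ := domain_mvt (f := fun y => f y i)
      (f' := fun y => (ContinuousLinearMap.proj i).comp (fderiv ℝ f y))
      (fun y _ => ((hasFDerivAt_pi'.1
        (hC1.differentiable one_ne_zero y).hasFDerivAt) i).hasFDerivWithinAt) hcv hxm hzm
    exact ⟨fderiv ℝ f c, hL c (hcv.segment_subset hxm hzm hc), hMetzler c i, he⟩
  have hw : ∀ t ∈ Set.Icc 0 T, ∀ i,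
      HasDerivAt (fun s => z s i - x s i) (f (z t) i - f (x t) i) t := fun t ht i =>
    ((hasDerivAt_pi.1 (hz t ht)) i).sub ((hasDerivAt_pi.1 (hx t ht)) i)
  have hexp : ∀ K t : ℝ, HasDerivAt (fun s => Real.exp (K * s)) (Real.exp (K * t) * K) t := by
    intro K t
    simpa using ((hasDerivAt_id t).const_mul K).exp
  -- weak monotonicity with slack
  have slack : ∀ ε > 0, ∀ t ∈ Set.Icc 0 T, ∀ i,
      0 < z t i - x t i + ε * Real.exp ((L + 1) * t) := by
    intro ε hε
    by_contra hcon
    push Not at hcon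
    obtain ⟨t1, ht1, i1, hi1⟩ := hcon
    let g : Fin n → ℝ → ℝ := fun i s => z s i - x s i + ε * Real.exp ((L + 1) * s)
    have hg : ∀ i, ∀ t ∈ Set.Icc 0 T, HasDerivAt (g i)
        (f (z t) i - f (x t) i + ε * (Real.exp ((L + 1) * t) * (L + 1))) t := fun i t ht =>
      (hw t ht i).add ((hexp (L + 1) t).const_mul ε)
    have hgc : ∀ i, ContinuousOn (g i) (Set.Icc 0 T) := fun i t ht =>
      (hg i t ht).continuousAt.continuousWithinAt
    let S : Set ℝ := ⋃ i, (Set.Icc 0 T ∩ g i ⁻¹' Set.Iic 0)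
    have hSc : IsCompact S := isCompact_iUnion fun i =>
      isCompact_Icc.of_isClosed_subset
        ((hgc i).preimage_isClosed_of_isClosed isClosed_Icc isClosed_Iic) Set.inter_subset_left
    obtain ⟨t, htS, hmin⟩ := hSc.exists_isLeast ⟨t1, Set.mem_iUnion.2 ⟨i1, ht1, hi1⟩⟩
    obtain ⟨i, ht, hi⟩ := Set.mem_iUnion.1 htS
    have hi : g i t ≤ 0 := hi
    have ht0 : 0 < t := by
      rcases ht.1.lt_or_eq with h | h
      · exact h
      · exfalso
        subst h
        have := h0 i
        simp only [g, mul_zero, Real.exp_zero] at hi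
        linarith
    have hbefore : ∀ j s, 0 ≤ s → s < t → 0 < g j s := by
      intro j s hs hst
      by_contra hn
      push Not at hn
      have := hmin (Set.mem_iUnion.2 ⟨j, ⟨hs, hst.le.trans ht.2⟩, hn⟩)
      linarith
    have hat : ∀ j, 0 ≤ g j t := by
      intro j
      have h1 : Filter.Tendsto (g j) (nhdsWithin t (Set.Iio t)) (nhds (g j t)) :=
        (hg j t ht).continuousAt.tendsto.mono_left nhdsWithin_le_nhds
      refine ge_of_tendsto h1 ?_
      filter_upwards [Ioo_mem_nhdsLT ht0] with s hs
      exact (hbefore j s hs.1.le hs.2).le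
    have hd := typeK_aux_deriv (g i) _ t ht0 (hg i t ht) hi (hbefore i)
    obtain ⟨D, hDL, hDp, hDe⟩ := key t ht i
    have hm : 0 < ε * Real.exp ((L + 1) * t) := by positivity
    set m := ε * Real.exp ((L + 1) * t) with hmdef
    have hle := typeK_aux_mono D (fun _ => -m) (z t - x t) i hDp
      (by have := hat i; simp only [g, Pi.sub_apply] at *; linarith)
      (by intro j; have := hat j; simp only [g, Pi.sub_apply] at *; linarith)
    have hb := typeK_aux_bound D L m (fun _ => -m) hDL
      ((pi_norm_le_iff_of_nonneg hm.le).2 fun j => by simp [abs_of_pos hm]) i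
    have := (abs_le.1 hb).1
    rw [hDe, ← mul_assoc, ← hmdef] at hd
    nlinarith
  have weak : ∀ t ∈ Set.Icc 0 T, ∀ i, 0 ≤ z t i - x t i := by
    intro t ht i
    by_contra hn
    push Not at hn
    have hE := Real.exp_pos ((L + 1) * t)
    have := slack (-(z t i - x t i) / Real.exp ((L + 1) * t)) (div_pos (by linarith) hE) t ht i
    rw [div_mul_cancel₀ _ hE.ne'] at this
    linarith
  intro i hi t ht
  have hG : ∀ s ∈ Set.Icc 0 T, HasDerivAt (fun s => Real.exp (L * s) * (z s i - x s i))
      (Real.exp (L * s) * L * (z s i - x s i) + Real.exp (L * s) * (f (z s) i - f (x s) i)) s :=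
    fun s hs => (hexp L s).mul (hw s hs i)
  have hmono : MonotoneOn (fun s => Real.exp (L * s) * (z s i - x s i)) (Set.Icc 0 T) := by
    refine monotoneOn_of_deriv_nonneg (convex_Icc 0 T)
      (fun s hs => (hG s hs).continuousAt.continuousWithinAt)
      (fun s hs => (hG s (interior_subset hs)).differentiableAt.differentiableWithinAt) ?_
    intro s hs
    have hs := interior_subset hs
    rw [(hG s hs).deriv]
    obtain ⟨D, hDL, hDp, hDe⟩ := key s hs i
    have hwi := weak s hs i
    have hle := typeK_aux_mono D (Pi.single i (z s i - x s i)) (z s - x s) i hDp (by simp)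
      (by
        intro j
        by_cases h : j = i
        · subst h; simp
        · simpa [h] using weak s hs j)
    have hb := typeK_aux_bound D L (z s i - x s i) (Pi.single i (z s i - x s i)) hDL
      ((pi_norm_le_iff_of_nonneg hwi).2 fun j => by
        by_cases h : j = i
        · subst h; rw [Pi.single_eq_same, Real.norm_eq_abs, abs_of_nonneg hwi]
        · simpa [h] using hwi) i
    have := (abs_le.1 hb).1
    rw [hDe, mul_assoc, ← mul_add]
    exact mul_nonneg (Real.exp_pos _).le (by linarith)
  have h1 := hmono ⟨le_rfl, hT.le⟩ ht ht.1
  simp only [mul_zero, Real.exp_zero, one_mul] at h1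
  have h2 : 0 < Real.exp (L * t) * (z t i - x t i) := by linarith
  have := (pos_iff_pos_of_mul_pos h2).1 (Real.exp_pos _)
  linarith
end

section
/- Let f : ℝⁿ → ℝⁿ be continuously differentiable with ∂f_i/∂x_j(x) ≥ 0 for all i ≠ j and all x, and with f(x + α𝟏) = f(x) for all x ∈ ℝⁿ and α ∈ ℝ. Suppose there exists x_e ∈ ℝⁿ with f(x_e) = 0. Then for every differentiable x : [0,∞) → ℝⁿ with x'(t) = f(x(t)) for all t ≥ 0 there exists x* ∈ ℝⁿ with f(x*) = 0 such that x(t) → x* as t → ∞ (i.e., every trajectory of the K-topical continuous-time system converges to an equilibrium point). -/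
open Filter

/-- The structural hypotheses on the vector field. -/
structure KTop (n : ℕ) (f : (Fin n → ℝ) → (Fin n → ℝ)) : Prop where
  c1 : ContDiff ℝ 1 f
  metz : ∀ (x : Fin n → ℝ) (i j : Fin n), i ≠ j → 0 ≤ fderiv ℝ f x (Pi.single j 1) i
  ph : ∀ (x : Fin n → ℝ) (α : ℝ), f (x + α • (1 : Fin n → ℝ)) = f x

namespace KTop

variable {n : ℕ} {f : (Fin n → ℝ) → (Fin n → ℝ)}

lemma neg (h : KTop n f) : KTop n (fun x => - f (-x)) := by
  have hd : ∀ x, fderiv ℝ (fun x => - f (-x)) x = fderiv ℝ f (-x) := by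
    intro x
    have h1 : HasFDerivAt f (fderiv ℝ f (-x)) (-x) :=
      ((h.c1.differentiable (by simp)) (-x)).hasFDerivAt
    have h2 : HasFDerivAt (fun x : Fin n → ℝ => -x) (-(ContinuousLinearMap.id ℝ _)) x :=
      (hasFDerivAt_id x).neg
    have h3 := (h1.comp x h2).neg
    have h4 := h3.fderiv
    have h5 : (-(f ∘ fun x : Fin n → ℝ => -x)) = (fun x => - f (-x)) := rfl
    rw [h5] at h4; rw [h4]; ext; simp
  refine ⟨?_, ?_, ?_⟩
  · exact (h.c1.comp contDiff_neg).neg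
  · intro x i j hij
    rw [hd]; exact h.metz _ i j hij
  · intro x α
    have := h.ph (-x) (-α)
    have e : -(x + α • (1 : Fin n → ℝ)) = -x + (-α) • (1 : Fin n → ℝ) := by
      rw [neg_smul]; abel
    simp only [e, this]

lemma hasF (h : KTop n f) (x : Fin n → ℝ) : HasFDerivAt f (fderiv ℝ f x) x :=
  ((h.c1.differentiable (by simp)) x).hasFDerivAt

lemma row (x u : Fin n → ℝ) (i : Fin n) :
    fderiv ℝ f x u i = ∑ j, u j * fderiv ℝ f x (Pi.single j 1) i := by
  have e : u = ∑ j, u j • (Pi.single j (1:ℝ) : Fin n → ℝ) := by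
    ext k
    simp [Finset.sum_apply, Pi.single_apply]
  conv_lhs => rw [e]
  simp only [map_sum, map_smul, Finset.sum_apply, Pi.smul_apply, smul_eq_mul]

lemma J_ge (h : KTop n f) (x u : Fin n → ℝ) (i : Fin n) (hu : ∀ j, j ≠ i → 0 ≤ u j) :
    u i * fderiv ℝ f x (Pi.single i 1) i ≤ fderiv ℝ f x u i := by
  rw [row x u i, ← Finset.add_sum_erase _ _ (Finset.mem_univ i)]
  have : 0 ≤ ∑ j ∈ Finset.univ.erase i, u j * fderiv ℝ f x (Pi.single j 1) i := by
    refine Finset.sum_nonneg fun j hj => ?_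
    have hj' := Finset.ne_of_mem_erase hj
    exact mul_nonneg (hu j hj') (h.metz x i j hj'.symm)
  linarith

lemma J_one (h : KTop n f) (x : Fin n → ℝ) : fderiv ℝ f x (1 : Fin n → ℝ) = 0 := by
  have h1 : HasDerivAt (fun α : ℝ => x + α • (1 : Fin n → ℝ)) (1 : Fin n → ℝ) 0 := by
    have := ((hasDerivAt_id (0:ℝ)).smul_const (1 : Fin n → ℝ)).const_add x
    simpa using this
  have h0 : HasFDerivAt f (fderiv ℝ f x) (x + (0:ℝ) • (1 : Fin n → ℝ)) := by
    simpa using h.hasF x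
  have h2 := h0.comp_hasDerivAt (0:ℝ) h1
  have e : (f ∘ fun α : ℝ => x + α • (1 : Fin n → ℝ)) = fun _ => f x := by
    funext α; exact h.ph x α
  rw [e] at h2
  exact h2.unique (hasDerivAt_const _ _)

/-- Quasi-monotonicity. -/
lemma quasi (h : KTop n f) (y w : Fin n → ℝ) (i : Fin n) (hyw : ∀ j, y j ≤ w j)
    (hi : y i = w i) : f y i ≤ f w i := by
  have hd : ∀ s : ℝ, HasDerivAt (fun s : ℝ => f (y + s • (w - y)) i)
      (fderiv ℝ f (y + s • (w - y)) (w - y) i) s := by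
    intro s
    have h1 : HasDerivAt (fun s : ℝ => y + s • (w - y)) (w - y) s := by
      have := ((hasDerivAt_id s).smul_const (w - y)).const_add y
      simpa using this
    exact hasDerivAt_pi.1 ((h.hasF _).comp_hasDerivAt s h1) i
  have hm : Monotone (fun s : ℝ => f (y + s • (w - y)) i) := by
    apply monotone_of_deriv_nonneg (fun s => (hd s).differentiableAt)
    intro s
    rw [(hd s).deriv]
    have := h.J_ge (y + s • (w - y)) (w - y) i (fun j _ => by simpa using hyw j)
    have e : (w - y) i = 0 := by simp [hi]
    rw [e, zero_mul] at this
    exact this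
  have := hm (zero_le_one (α := ℝ))
  simpa using this

/-- Maximum principle. -/
lemma maxp (u u' : ℝ → Fin n → ℝ) (hu : ∀ t, 0 ≤ t → HasDerivAt u (u' t) t)
    (hmax : ∀ t, 0 ≤ t → ∀ i, (∀ j, u t j ≤ u t i) → u' t i ≤ 0)
    (s : ℝ) (hs : 0 ≤ s) (K : ℝ) (hK : ∀ i, u s i ≤ K) (t : ℝ) (hst : s ≤ t) (i : Fin n) :
    u t i ≤ K := by
  have hc : ∀ t, 0 ≤ t → ∀ j, HasDerivAt (fun t => u t j) (u' t j) t :=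
    fun t ht j => hasDerivAt_pi.1 (hu t ht) j
  have key : ∀ δ > 0, u t i < K + δ + δ * (t - s) := by
    intro δ hδ
    by_contra hcon
    push Not at hcon
    let g : Fin n → ℝ → ℝ := fun j r => u r j - (K + δ + δ * (r - s))
    have hg : ∀ r, 0 ≤ r → ∀ j, HasDerivAt (g j) (u' r j - δ) r := by
      intro r hr j
      have h1 : HasDerivAt (fun r : ℝ => K + δ + δ * (r - s)) δ r := by
        have := (((hasDerivAt_id r).sub_const s).const_mul δ).const_add (K + δ)
        simpa using this
      exact (hc r hr j).sub h1
    let S : Set ℝ := ⋃ j, (Set.Icc s t ∩ (g j) ⁻¹' (Set.Ici 0))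
    have hSc : IsClosed S := by
      refine isClosed_iUnion_of_finite fun j => ?_
      refine ContinuousOn.preimage_isClosed_of_isClosed ?_ isClosed_Icc isClosed_Ici
      intro r hr
      exact (hg r (hs.trans hr.1) j).continuousAt.continuousWithinAt
    have htS : t ∈ S := Set.mem_iUnion.2 ⟨i, ⟨hst, le_rfl⟩, by
      show 0 ≤ u t i - (K + δ + δ * (t - s)); linarith⟩
    have hbd : BddBelow S := ⟨s, fun r hr => by
      obtain ⟨j, hj⟩ := Set.mem_iUnion.1 hr; exact hj.1.1⟩
    have hτ := hSc.csInf_mem ⟨t, htS⟩ hbd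
    set τ := sInf S
    obtain ⟨k, ⟨hsτ, hτt⟩, hk⟩ := Set.mem_iUnion.1 hτ
    have hk : 0 ≤ g k τ := hk
    have hneg : ∀ r, s ≤ r → r < τ → ∀ j, g j r < 0 := by
      intro r h1 h2 j
      by_contra h3
      push Not at h3
      have : r ∈ S := Set.mem_iUnion.2 ⟨j, ⟨h1, h2.le.trans hτt⟩, h3⟩
      exact absurd (csInf_le hbd this) (not_le.2 h2)
    have hsτ' : s < τ := by
      rcases hsτ.lt_or_eq with h | h
      · exact h
      · exfalso
        rw [← h] at hk
        have h1 : 0 ≤ u s k - (K + δ + δ * (s - s)) := hk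
        have := hK k
        rw [sub_self, mul_zero] at h1
        linarith
    have h0τ : 0 ≤ τ := hs.trans hsτ
    have hev : ∀ᶠ r in nhdsWithin τ (Set.Iio τ), s < r ∧ r < τ := by
      filter_upwards [Ioo_mem_nhdsLT hsτ'] with r hr using hr
    have hle : ∀ j, g j τ ≤ 0 := by
      intro j
      have hcont : Tendsto (g j) (nhdsWithin τ (Set.Iio τ)) (nhds (g j τ)) :=
        (hg τ h0τ j).continuousAt.continuousWithinAt
      refine le_of_tendsto hcont ?_
      filter_upwards [hev] with r hr using (hneg r hr.1.le hr.2 j).le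
    have hk0 : g k τ = 0 := le_antisymm (hle k) hk
    have hd0 : u' τ k ≤ 0 := by
      refine hmax τ h0τ k fun j => ?_
      have h1 : u τ j - (K + δ + δ * (τ - s)) ≤ 0 := hle j
      have h2 : 0 ≤ u τ k - (K + δ + δ * (τ - s)) := hk
      linarith
    have hslope : 0 ≤ u' τ k - δ := by
      have h1 := (hasDerivAt_iff_tendsto_slope_left_right.1 (hg τ h0τ k)).1
      refine ge_of_tendsto h1 ?_
      filter_upwards [hev] with r hr
      rw [slope_def_field, hk0]
      have := hneg r hr.1.le hr.2 k
      exact div_nonneg_of_nonpos (by linarith) (by linarith [hr.2])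
    linarith
  refine le_of_forall_pos_lt_add fun ε hε => ?_
  have hp : 0 < 1 + (t - s) := by linarith
  have := key (ε / (1 + (t - s))) (by positivity)
  have e : ε / (1 + (t - s)) + ε / (1 + (t - s)) * (t - s) = ε := by
    field_simp
  linarith

/-- Upper bound relative to an equilibrium. -/
lemma upper (h : KTop n f) (e : Fin n → ℝ) (he : f e = 0) (x : ℝ → Fin n → ℝ)
    (hx : ∀ t : ℝ, 0 ≤ t → HasDerivAt x (f (x t)) t) (s : ℝ) (hs : 0 ≤ s) (K : ℝ)
    (hK : ∀ i, x s i - e i ≤ K) (t : ℝ) (hst : s ≤ t) (i : Fin n) : x t i - e i ≤ K := by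
  refine maxp (fun t => x t - e) (fun t => f (x t)) (fun t ht => (hx t ht).sub_const e) ?_
    s hs K hK t hst i
  intro t ht i hi
  have := h.quasi (x t) (e + (x t i - e i) • (1 : Fin n → ℝ)) i (fun j => by
    have := hi j
    simp only [Pi.sub_apply] at this
    simp; linarith) (by simp)
  rw [h.ph, he] at this
  simpa using this

lemma lower (h : KTop n f) (e : Fin n → ℝ) (he : f e = 0) (x : ℝ → Fin n → ℝ)
    (hx : ∀ t : ℝ, 0 ≤ t → HasDerivAt x (f (x t)) t) (s : ℝ) (hs : 0 ≤ s) (K : ℝ)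
    (hK : ∀ i, e i - x s i ≤ K) (t : ℝ) (hst : s ≤ t) (i : Fin n) : e i - x t i ≤ K := by
  have := h.neg.upper (-e) (by simp [he]) (fun t => - x t)
    (fun t ht => by simp only [neg_neg]; exact (hx t ht).neg) s hs K
    (fun i => by have := hK i; simp; linarith) t hst i
  simp at this
  linarith

lemma dist_mono (h : KTop n f) (e : Fin n → ℝ) (he : f e = 0) (x : ℝ → Fin n → ℝ)
    (hx : ∀ t : ℝ, 0 ≤ t → HasDerivAt x (f (x t)) t) (s : ℝ) (hs : 0 ≤ s)
    (t : ℝ) (hst : s ≤ t) : dist (x t) e ≤ dist (x s) e := by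
  rw [dist_pi_le_iff dist_nonneg]
  intro i
  have hb : ∀ i, |x s i - e i| ≤ dist (x s) e := fun i => by
    rw [← Real.dist_eq]; exact dist_le_pi_dist _ _ i
  rw [Real.dist_eq, abs_le]
  have h1 := h.upper e he x hx s hs _ (fun i => (abs_le.1 (hb i)).2) t hst i
  have h2 := h.lower e he x hx s hs (dist (x s) e)
    (fun i => by linarith [(abs_le.1 (hb i)).1]) t hst i
  exact ⟨by linarith, h1⟩

lemma vel_deriv (h : KTop n f) (x : ℝ → Fin n → ℝ)
    (hx : ∀ t : ℝ, 0 ≤ t → HasDerivAt x (f (x t)) t) (t : ℝ) (ht : 0 ≤ t) :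
    HasDerivAt (fun t => f (x t)) (fderiv ℝ f (x t) (f (x t))) t :=
  (h.hasF (x t)).comp_hasDerivAt t (hx t ht)

lemma vel_max (h : KTop n f) (x : ℝ → Fin n → ℝ)
    (hx : ∀ t : ℝ, 0 ≤ t → HasDerivAt x (f (x t)) t) (s : ℝ) (hs : 0 ≤ s) (K : ℝ)
    (hK : ∀ i, f (x s) i ≤ K) (t : ℝ) (hst : s ≤ t) (i : Fin n) : f (x t) i ≤ K := by
  refine maxp (fun t => f (x t)) (fun t => fderiv ℝ f (x t) (f (x t)))
    (h.vel_deriv x hx) ?_ s hs K hK t hst i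
  intro t ht i hi
  have := h.J_ge (x t) ((f (x t) i) • (1 : Fin n → ℝ) - f (x t)) i
    (fun j _ => by have := hi j; simp; linarith)
  rw [map_sub, map_smul, h.J_one] at this
  simpa using this

lemma vel_upper (h : KTop n f) (x : ℝ → Fin n → ℝ)
    (hx : ∀ t : ℝ, 0 ≤ t → HasDerivAt x (f (x t)) t) (R : ℝ) (hR : ∀ t, 0 ≤ t → ‖x t‖ ≤ R)
    (η : ℝ) (hη : 0 < η) : ∃ T, 0 ≤ T ∧ ∀ t, T ≤ t → ∀ i, f (x t) i ≤ η := by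
  suffices hs : ∃ T, 0 ≤ T ∧ ∀ i, f (x T) i ≤ η by
    obtain ⟨T, hT, hT2⟩ := hs
    exact ⟨T, hT, fun t ht i => h.vel_max x hx T hT η hT2 t ht i⟩
  by_contra hcon
  push Not at hcon
  have hR0 : 0 ≤ R := (norm_nonneg _).trans (hR 0 le_rfl)
  -- bound on the Jacobian
  obtain ⟨c, hc⟩ : ∃ c, ∀ y ∈ Metric.closedBall (0 : Fin n → ℝ) R, ‖fderiv ℝ f y‖ ≤ c :=
    (isCompact_closedBall (0 : Fin n → ℝ) R).exists_bound_of_continuousOn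
      (h.c1.continuous_fderiv (by simp)).continuousOn
  have hJ : ∀ t, 0 ≤ t → ∀ i, -c ≤ fderiv ℝ f (x t) (Pi.single i 1) i := by
    intro t ht i
    have h1 := hc (x t) (by simpa using hR t ht)
    have h2 : ‖fderiv ℝ f (x t) (Pi.single i 1) i‖ ≤ ‖fderiv ℝ f (x t) (Pi.single i 1)‖ :=
      norm_le_pi_norm _ i
    have h3 := (fderiv ℝ f (x t)).le_opNorm (Pi.single i 1)
    have h4 : ‖(Pi.single i (1:ℝ) : Fin n → ℝ)‖ = 1 := by
      rw [Pi.norm_single]; simp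
    rw [h4, mul_one] at h3
    rw [Real.norm_eq_abs] at h2
    linarith [neg_abs_le (fderiv ℝ f (x t) (Pi.single i 1) i)]
  let S : Set ℝ := {K | ∃ t, 0 ≤ t ∧ ∀ i, f (x t) i ≤ K}
  have hSne : S.Nonempty := ⟨‖f (x 0)‖, 0, le_rfl, fun i =>
    (le_abs_self _).trans (norm_le_pi_norm (f (x 0)) i)⟩
  have hSb : ∀ K ∈ S, η ≤ K := by
    rintro K ⟨t, ht, hK⟩
    obtain ⟨i, hi⟩ := hcon t ht
    exact hi.le.trans (hK i)
  have hSbd : BddBelow S := ⟨η, hSb⟩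
  set M := sInf S with hM
  have hMη : η ≤ M := le_csInf hSne hSb
  obtain ⟨H, hH⟩ : ∃ H, H = (4 * R + 2) / η := ⟨_, rfl⟩
  have hH0 : 0 < H := by rw [hH]; positivity
  obtain ⟨ε, hε⟩ : ∃ ε, ε = η / (4 * Real.exp (c * H)) := ⟨_, rfl⟩
  have hε0 : 0 < ε := by rw [hε]; positivity
  have hεe : 2 * ε * Real.exp (c * H) = η / 2 := by
    rw [hε]; have := (Real.exp_pos (c * H)).ne'; field_simp; norm_num
  obtain ⟨K, ⟨T, hT0, hTK⟩, hKlt⟩ := exists_lt_of_csInf_lt hSne (show sInf S < M + ε by linarith)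
  have hup : ∀ t, T ≤ t → ∀ i, f (x t) i ≤ M + ε := fun t ht i =>
    h.vel_max x hx T hT0 (M + ε) (fun i => (hTK i).trans hKlt.le) t ht i
  obtain ⟨i, hi⟩ : ∃ i, M - ε < f (x (T + H)) i := by
    by_contra hno
    push Not at hno
    have : M - ε ∈ S := ⟨T + H, by linarith, hno⟩
    have := csInf_le hSbd this
    linarith
  -- the weighted deficit is monotone
  have hwd : ∀ t, T ≤ t → HasDerivAt (fun t => Real.exp (c * t) * (M + ε - f (x t) i))
      (Real.exp (c * t) * c * (M + ε - f (x t) i)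
        + Real.exp (c * t) * (- fderiv ℝ f (x t) (f (x t)) i)) t := by
    intro t ht
    have h1 : HasDerivAt (fun t : ℝ => Real.exp (c * t)) (Real.exp (c * t) * c) t := by
      have := ((hasDerivAt_id t).const_mul c).exp
      simpa using this
    have h2 := (hasDerivAt_pi.1 (h.vel_deriv x hx t (hT0.trans ht)) i).const_sub (M + ε)
    exact h1.mul h2
  have hmono : MonotoneOn (fun t => Real.exp (c * t) * (M + ε - f (x t) i)) (Set.Ici T) := by
    refine monotoneOn_of_hasDerivWithinAt_nonneg (convex_Ici T)
      (fun t ht => (hwd t ht).continuousAt.continuousWithinAt)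
      (fun t ht => (hwd t (interior_subset ht)).hasDerivWithinAt) ?_
    intro t ht
    have ht : T ≤ t := interior_subset ht
    have h1 := h.J_ge (x t) ((M + ε) • (1 : Fin n → ℝ) - f (x t)) i
      (fun j _ => by have := hup t ht j; simp; linarith)
    rw [map_sub, map_smul, h.J_one] at h1
    simp only [Pi.sub_apply, Pi.smul_apply, Pi.one_apply, smul_eq_mul, mul_one, smul_zero,
      Pi.zero_apply] at h1
    have h2 := hJ t (hT0.trans ht) i
    have h3 : 0 ≤ M + ε - f (x t) i := by linarith [hup t ht i]
    have h4 := mul_le_mul_of_nonneg_left h2 h3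
    have h5 : 0 ≤ c * (M + ε - f (x t) i) + (- fderiv ℝ f (x t) (f (x t)) i) := by linarith
    have h6 := mul_nonneg (Real.exp_pos (c * t)).le h5
    linarith
  have hc0 : 0 ≤ c := (norm_nonneg _).trans (hc 0 (by simpa using hR0))
  have hlow : ∀ t, T ≤ t → t ≤ T + H → η / 2 ≤ f (x t) i := by
    intro t h1 h2
    have h3 : Real.exp (c * t) * (M + ε - f (x t) i)
        ≤ Real.exp (c * (T + H)) * (M + ε - f (x (T + H)) i) :=
      hmono h1 (show T ≤ T + H by linarith) h2
    have h4 : 0 ≤ M + ε - f (x t) i := by linarith [hup t h1 i]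
    have h5 : Real.exp (c * T) ≤ Real.exp (c * t) :=
      Real.exp_le_exp.2 (mul_le_mul_of_nonneg_left h1 hc0)
    have h6 : Real.exp (c * T) * (M + ε - f (x t) i)
        ≤ Real.exp (c * T) * (Real.exp (c * H) * (2 * ε)) := by
      calc _ ≤ Real.exp (c * t) * (M + ε - f (x t) i) := mul_le_mul_of_nonneg_right h5 h4
        _ ≤ Real.exp (c * (T + H)) * (M + ε - f (x (T + H)) i) := h3
        _ ≤ Real.exp (c * (T + H)) * (2 * ε) :=
          mul_le_mul_of_nonneg_left (by linarith) (Real.exp_pos _).le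
        _ = _ := by rw [mul_add, Real.exp_add]; ring
    have h7 := le_of_mul_le_mul_left h6 (Real.exp_pos _)
    linarith
  have hxm : MonotoneOn (fun t => x t i - η / 2 * t) (Set.Icc T (T + H)) := by
    have hd : ∀ t, T ≤ t → HasDerivAt (fun t => x t i - η / 2 * t) (f (x t) i - η / 2) t := by
      intro t ht
      have h1 : HasDerivAt (fun t : ℝ => η / 2 * t) (η / 2) t := by
        simpa using (hasDerivAt_id t).const_mul (η / 2)
      exact (hasDerivAt_pi.1 (hx t (hT0.trans ht)) i).sub h1
    refine monotoneOn_of_hasDerivWithinAt_nonneg (convex_Icc _ _)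
      (fun t ht => (hd t ht.1).continuousAt.continuousWithinAt)
      (fun t ht => (hd t (interior_subset ht).1).hasDerivWithinAt) ?_
    intro t ht
    have ht := interior_subset ht
    linarith [hlow t ht.1 ht.2]
  have hfin : x T i - η / 2 * T ≤ x (T + H) i - η / 2 * (T + H) :=
    hxm ⟨le_rfl, by linarith⟩ ⟨by linarith, le_rfl⟩ (by linarith)
  have hηH : η * H = 4 * R + 2 := by rw [hH]; field_simp
  have hb : ∀ t, 0 ≤ t → |x t i| ≤ R := fun t ht => (norm_le_pi_norm (x t) i).trans (hR t ht)
  have b1 := abs_le.1 (hb T hT0)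
  have b2 := abs_le.1 (hb (T + H) (by linarith))
  nlinarith [b1.1, b2.2]

end KTop

/-- If `f : ℝⁿ → ℝⁿ` is `C¹` with Metzler Jacobian, translation invariant
(`f (x + α𝟏) = f x`), and has at least one equilibrium point, then every global solution of
`ẋ = f(x)` converges to an equilibrium point. -/
theorem ktopical_ct_trajectories_converge
    (n : ℕ) (f : (Fin n → ℝ) → (Fin n → ℝ))
    (hC1 : ContDiff ℝ 1 f)
    (hMetzler : ∀ (x : Fin n → ℝ) (i j : Fin n), i ≠ j →
      0 ≤ fderiv ℝ f x (Pi.single j 1) i)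
    (hph : ∀ (x : Fin n → ℝ) (α : ℝ), f (x + α • (1 : Fin n → ℝ)) = f x)
    (heq : ∃ x_e : Fin n → ℝ, f x_e = 0) :
    ∀ x : ℝ → (Fin n → ℝ), (∀ t : ℝ, 0 ≤ t → HasDerivAt x (f (x t)) t) →
      ∃ xs : Fin n → ℝ, f xs = 0 ∧ Tendsto x atTop (nhds xs) := by
  intro x hx
  have h : KTop n f := ⟨hC1, hMetzler, hph⟩
  obtain ⟨e, he⟩ := heq
  obtain ⟨R, hR⟩ : ∃ R, ∀ t, 0 ≤ t → ‖x t‖ ≤ R := by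
    refine ⟨dist (x 0) e + ‖e‖, fun t ht => ?_⟩
    have h1 := h.dist_mono e he x hx 0 le_rfl t ht
    have h2 := norm_le_norm_add_norm_sub' (x t) e
    rw [← dist_eq_norm] at h2
    linarith
  have hv : Tendsto (fun t => f (x t)) atTop (nhds 0) := by
    rw [Metric.tendsto_atTop]
    intro ε hε
    obtain ⟨T1, hT1, h1⟩ := h.vel_upper x hx R hR (ε / 2) (by linarith)
    obtain ⟨T2, hT2, h2⟩ := h.neg.vel_upper (fun t => - x t)
      (fun t ht => by simp only [neg_neg]; exact (hx t ht).neg) R (fun t ht => by simpa using hR t ht)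
      (ε / 2) (by linarith)
    refine ⟨max T1 T2, fun t ht => ?_⟩
    refine lt_of_le_of_lt ?_ (half_lt_self hε)
    rw [dist_pi_le_iff (by linarith)]
    intro i
    have a1 := h1 t ((le_max_left _ _).trans ht) i
    have a2 := h2 t ((le_max_right _ _).trans ht) i
    simp only [neg_neg, Pi.neg_apply] at a2
    rw [Real.dist_eq, abs_le]
    simp only [Pi.zero_apply, sub_zero]
    exact ⟨by linarith, a1⟩
  obtain ⟨xs, -, φ, hφ, hlim⟩ := (isCompact_closedBall (0 : Fin n → ℝ) R).tendsto_subseq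
    (x := fun k : ℕ => x k) (fun k => by simpa using hR k (Nat.cast_nonneg k))
  have hφt : Tendsto (fun k => ((φ k : ℕ) : ℝ)) atTop atTop :=
    tendsto_natCast_atTop_atTop.comp hφ.tendsto_atTop
  have hxs : f xs = 0 := by
    have l1 : Tendsto (fun k => f (x (φ k))) atTop (nhds (f xs)) :=
      (hC1.continuous.tendsto xs).comp hlim
    exact tendsto_nhds_unique l1 (hv.comp hφt)
  refine ⟨xs, hxs, ?_⟩
  rw [Metric.tendsto_atTop] at hlim ⊢
  intro ε hε
  obtain ⟨N, hN⟩ := hlim ε hε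
  refine ⟨(φ N : ℝ), fun t ht => ?_⟩
  exact (h.dist_mono xs hxs x hx (φ N) (Nat.cast_nonneg _) t ht).trans_lt (hN N le_rfl)
end

section
/- Let f : ℝⁿ → ℝⁿ be continuously differentiable with ∂f_i/∂x_j(x) ≥ 0 for all i ≠ j and all x, and with f(x + α𝟏) = f(x) for all x ∈ ℝⁿ and α ∈ ℝ. Then every equilibrium point x_e (i.e., f(x_e) = 0) is Lyapunov stable: for every ε > 0 there exists δ > 0 such that every differentiable x : [0,∞) → ℝⁿ with x'(t) = f(x(t)) for all t ≥ 0 and ‖x(0) − x_e‖_∞ < δ satisfies ‖x(t) − x_e‖_∞ < ε for all t ≥ 0. -/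
theorem euler_step_norm_le (n : ℕ) (L : (Fin n → ℝ) →L[ℝ] (Fin n → ℝ))
    (hM : ∀ i j : Fin n, i ≠ j → 0 ≤ L (Pi.single j 1) i) (h1 : L 1 = 0)
    (h : ℝ) (h0 : 0 ≤ h) (hL : h * ‖L‖ ≤ 1) :
    ‖ContinuousLinearMap.id ℝ (Fin n → ℝ) + h • L‖ ≤ 1 := by
  set A := ContinuousLinearMap.id ℝ (Fin n → ℝ) + h • L with hA
  have hdec : ∀ v : Fin n → ℝ, ∀ i, A v i = ∑ j, v j * A (Pi.single j 1) i := by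
    intro v i
    have hv : v = ∑ j, v j • (Pi.single j 1 : Fin n → ℝ) := pi_eq_sum_univ' v
    conv_lhs => rw [hv]
    simp only [map_sum, map_smul, Finset.sum_apply, Pi.smul_apply, smul_eq_mul]
  have hpos : ∀ i j, 0 ≤ A (Pi.single j 1) i := by
    intro i j
    have e : A (Pi.single j 1) i = (Pi.single j 1 : Fin n → ℝ) i + h * L (Pi.single j 1) i := by
      simp [hA]
    rw [e]
    by_cases hij : i = j
    · subst hij
      have a1 : |L (Pi.single i 1) i| ≤ ‖L‖ := by
        have b1 := norm_le_pi_norm (L (Pi.single i 1)) i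
        have b2 := L.le_opNorm (Pi.single i 1)
        have b3 : ‖(Pi.single i 1 : Fin n → ℝ)‖ = 1 := by simp [Pi.norm_single]
        rw [b3, mul_one] at b2
        exact (Real.norm_eq_abs _) ▸ b1.trans b2
      have a2 := neg_le_of_abs_le a1
      simp only [Pi.single_eq_same]
      nlinarith
    · simp only [Pi.single_eq_of_ne hij, zero_add]
      exact mul_nonneg h0 (hM i j hij)
  refine ContinuousLinearMap.opNorm_le_bound _ zero_le_one fun v => ?_
  rw [one_mul]
  refine (pi_norm_le_iff_of_nonneg (norm_nonneg v)).2 fun i => ?_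
  have hs : ∑ j, A (Pi.single j 1) i = 1 := by
    have := hdec 1 i
    simp only [Pi.one_apply, one_mul] at this
    rw [← this]
    simp [hA, h1]
  rw [hdec v i]
  calc ‖∑ j, v j * A (Pi.single j 1) i‖ ≤ ∑ j, ‖v j * A (Pi.single j 1) i‖ := norm_sum_le _ _
    _ ≤ ∑ j, ‖v‖ * A (Pi.single j 1) i := by
        refine Finset.sum_le_sum fun j _ => ?_
        rw [norm_mul, Real.norm_of_nonneg (hpos i j)]
        exact mul_le_mul_of_nonneg_right (norm_le_pi_norm v j) (hpos i j)
    _ = ‖v‖ := by rw [← Finset.mul_sum, hs, mul_one]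

theorem fderiv_one_eq_zero (n : ℕ) (f : (Fin n → ℝ) → (Fin n → ℝ))
    (hC1 : ContDiff ℝ 1 f)
    (hph : ∀ (x : Fin n → ℝ) (α : ℝ), f (x + α • (1 : Fin n → ℝ)) = f x) (x : Fin n → ℝ) :
    fderiv ℝ f x 1 = 0 := by
  have hd : DifferentiableAt ℝ f x := hC1.differentiable (by norm_num) x
  have h1 : HasLineDerivAt ℝ f (fderiv ℝ f x 1) x 1 := hd.hasFDerivAt.hasLineDerivAt 1
  unfold HasLineDerivAt at h1
  simp only [hph] at h1
  exact h1.unique (hasDerivAt_const _ _)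

theorem euler_step_le (n : ℕ) (f : (Fin n → ℝ) → (Fin n → ℝ))
    (hC1 : ContDiff ℝ 1 f)
    (hMetzler : ∀ (x : Fin n → ℝ) (i j : Fin n), i ≠ j →
      0 ≤ fderiv ℝ f x (Pi.single j 1) i)
    (hph : ∀ (x : Fin n → ℝ) (α : ℝ), f (x + α • (1 : Fin n → ℝ)) = f x)
    (x_e : Fin n → ℝ) (heq : f x_e = 0) (y : Fin n → ℝ) :
    ∃ h₀ > (0 : ℝ), ∀ h, 0 ≤ h → h < h₀ → ‖y + h • f y - x_e‖ ≤ ‖y - x_e‖ := by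
  have hcomp : IsCompact (segment ℝ x_e y) := by
    rw [segment_eq_image_lineMap]
    exact isCompact_Icc.image AffineMap.lineMap_continuous
  obtain ⟨C, hC⟩ := hcomp.exists_bound_of_continuousOn
    (hC1.continuous_fderiv (by norm_num)).continuousOn
  have hC0 : 0 ≤ C := (norm_nonneg _).trans (hC x_e (left_mem_segment ℝ _ _))
  refine ⟨1 / (C + 1), by positivity, fun h h0 hlt => ?_⟩
  have hhC : h * (C + 1) ≤ 1 := by
    rw [lt_div_iff₀ (by positivity)] at hlt
    exact hlt.le
  have key := (convex_segment (𝕜 := ℝ) x_e y).norm_image_sub_le_of_norm_hasFDerivWithin_le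
    (f := fun z => z + h • f z)
    (f' := fun z => ContinuousLinearMap.id ℝ (Fin n → ℝ) + h • fderiv ℝ f z) (C := 1)
    (fun z _ => ((hasFDerivAt_id z).add
      ((hC1.differentiable (by norm_num) z).hasFDerivAt.const_smul h)).hasFDerivWithinAt)
    (fun z hz => euler_step_norm_le n _ (hMetzler z) (fderiv_one_eq_zero n f hC1 hph z) h h0
      (by have := hC z hz; nlinarith))
    (left_mem_segment ℝ _ _) (right_mem_segment ℝ _ _)
  simpa [heq] using key

/-- If `f : ℝⁿ → ℝⁿ` is `C¹` with Metzler Jacobian and translation invariant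
(`f (x + α𝟏) = f x`), then every equilibrium point `x_e` (with `f x_e = 0`) is Lyapunov stable
in the sup-norm (the norm on `Fin n → ℝ`). -/
theorem ktopical_ct_equilibria_stable
    (n : ℕ) (f : (Fin n → ℝ) → (Fin n → ℝ))
    (hC1 : ContDiff ℝ 1 f)
    (hMetzler : ∀ (x : Fin n → ℝ) (i j : Fin n), i ≠ j →
      0 ≤ fderiv ℝ f x (Pi.single j 1) i)
    (hph : ∀ (x : Fin n → ℝ) (α : ℝ), f (x + α • (1 : Fin n → ℝ)) = f x)
    (x_e : Fin n → ℝ) (heq : f x_e = 0) :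
    ∀ ε > (0 : ℝ), ∃ δ > (0 : ℝ),
      ∀ x : ℝ → (Fin n → ℝ), (∀ t : ℝ, 0 ≤ t → HasDerivAt x (f (x t)) t) →
        ‖x 0 - x_e‖ < δ → ∀ t : ℝ, 0 ≤ t → ‖x t - x_e‖ < ε := by
  intro ε hε
  refine ⟨ε, hε, fun x hx hx0 T hT => lt_of_le_of_lt ?_ hx0⟩
  refine image_le_of_liminf_slope_right_le_deriv_boundary (f := fun t => ‖x t - x_e‖)
    (a := 0) (b := T) (B := fun _ => ‖x 0 - x_e‖) (B' := fun _ => 0) ?_ le_rfl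
    continuousOn_const (fun t _ => hasDerivWithinAt_const _ _ _) ?_ ⟨hT, le_rfl⟩
  · intro t ht
    exact ((hx t ht.1).continuousAt.continuousWithinAt.sub continuousWithinAt_const).norm
  · intro t ht r hr
    obtain ⟨h₀, hh₀, hstep⟩ := euler_step_le n f hC1 hMetzler hph x_e heq (x t)
    have ho := (hasDerivAt_iff_isLittleO.1 (hx t ht.1)).def (half_pos hr)
    refine Filter.Eventually.frequently ?_
    have hI : Set.Ioo t (t + h₀) ∈ nhdsWithin t (Set.Ioi t) :=
      Ioo_mem_nhdsGT (by linarith)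
    filter_upwards [nhdsWithin_le_nhds ho, hI] with z hz hzI
    have hpos : 0 < z - t := sub_pos.2 hzI.1
    rw [slope_def_field, div_lt_iff₀ hpos]
    have h1 := hstep (z - t) hpos.le (by linarith [hzI.2])
    rw [Real.norm_of_nonneg hpos.le] at hz
    have h2 : x z - x_e = (x z - x t - (z - t) • f (x t)) + (x t + (z - t) • f (x t) - x_e) := by
      abel
    have h3 := norm_add_le (x z - x t - (z - t) • f (x t)) (x t + (z - t) • f (x t) - x_e)
    rw [← h2] at h3
    have h4 : 0 < r * (z - t) := mul_pos hr hpos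
    linarith
end
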